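/- arXiv:2008.00972 — 2 statements merged into one kernel-verified Lean document; each statement's English description precedes it below -/
import Mathlib

section
/- Consider the hard sphere model in ℝ^d: let r > 0 be the radius of the Euclidean ball of volume 1 in ℝ^d, and for a bounded measurable Λ ⊂ ℝ^d and real λ ≥ 0 let Z_Λ(λ) = Σ_{k≥0} (λ^k/k!) ∫_{Λ^k} ∏_{1≤i<j≤k} 1[‖x_i−x_j‖ ≥ r] dx_1⋯dx_k. Then there exist an open set Ω ⊂ ℂ containing the real interval [0, e) and an analytic function p : Ω → ℂ such that for every real λ ∈ [0, e), (1/V)·log Z_{Λ_V}(λ) converges to p(λ) as V → ∞, where Λ_V is the axis-parallel cube of volume V centered at the origin. (Analyticity of the hard sphere pressure for λ < e, Corollary 1.3.) -/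
open MeasureTheory Filter

noncomputable section

/-- Euclidean space ℝ^d. -/
abbrev Euc (d : ℕ) := EuclideanSpace ℝ (Fin d)

/-- The hard sphere pair weight `∏_{1 ≤ i < j ≤ k} 1[‖x_i - x_j‖ ≥ r]`. -/
def hsWeight (d : ℕ) (r : ℝ) (k : ℕ) (x : Fin k → Euc d) : ℝ :=
  ∏ p ∈ Finset.univ.filter (fun p : Fin k × Fin k => p.1 < p.2),
    (if r ≤ dist (x p.1) (x p.2) then (1 : ℝ) else 0)

/-- The hard sphere partition function `Z_Λ(λ)` at constant real activity `λ`. -/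
def Zhs (d : ℕ) (r : ℝ) (Λ : Set (Euc d)) (lam : ℝ) : ℝ :=
  ∑' k : ℕ, lam ^ k / (Nat.factorial k) *
    ∫ x in Set.univ.pi (fun _ : Fin k => Λ), hsWeight d r k x

/-- The axis-parallel cube of volume `V` centered at the origin in ℝ^d. -/
def cube (d : ℕ) (V : ℝ) : Set (Euc d) := {x | ∀ i, |x i| ≤ V ^ (1 / (d : ℝ)) / 2}

section

open scoped ENNReal Topology

/-- Hard sphere configurations of `k` labelled points in `A`. -/
def conf {d : ℕ} (r : ℝ) (k : ℕ) (A : Set (Euc d)) : Set (Fin k → Euc d) :=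
  {x | (∀ j, x j ∈ A) ∧ ∀ i j, i ≠ j → r ≤ dist (x i) (x j)}

/-- The partition function with values in `ℝ≥0∞`. -/
def ZE {d : ℕ} (r : ℝ) (l : ℝ≥0∞) (A : Set (Euc d)) : ℝ≥0∞ :=
  ∑' k : ℕ, l ^ k / (Nat.factorial k : ℝ≥0∞) * volume (conf r k A)

lemma conf_mono {d : ℕ} (r : ℝ) (k : ℕ) {A B : Set (Euc d)} (h : A ⊆ B) :
    conf r k A ⊆ conf r k B := fun _ hx => ⟨fun j => h (hx.1 j), hx.2⟩

lemma ZE_mono {d : ℕ} (r : ℝ) (l : ℝ≥0∞) {A B : Set (Euc d)} (h : A ⊆ B) :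
    ZE r l A ≤ ZE r l B :=
  ENNReal.tsum_le_tsum fun k => mul_le_mul_right (measure_mono (conf_mono r k h)) _

lemma measurableSet_conf_family {d : ℕ} {T : Type*} [MeasurableSpace T] (r : ℝ) (k : ℕ)
    {A : Set (T × Euc d)} (hA : MeasurableSet A) :
    MeasurableSet {p : T × (Fin k → Euc d) | p.2 ∈ conf r k {x | (p.1, x) ∈ A}} := by
  have h1 : {p : T × (Fin k → Euc d) | p.2 ∈ conf r k {x | (p.1, x) ∈ A}} =
      (⋂ j, (fun p : T × (Fin k → Euc d) => (p.1, p.2 j)) ⁻¹' A) ∩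
      ⋂ i, ⋂ j, ⋂ _ : i ≠ j, {p : T × (Fin k → Euc d) | r ≤ dist (p.2 i) (p.2 j)} := by
    ext p; simp [conf]
  rw [h1]
  refine MeasurableSet.inter (MeasurableSet.iInter fun j => ?_)
    (MeasurableSet.iInter fun i => MeasurableSet.iInter fun j => MeasurableSet.iInter fun _ => ?_)
  · exact (by fun_prop : Measurable (fun p : T × (Fin k → Euc d) => (p.1, p.2 j))) hA
  · exact measurableSet_le (by fun_prop) (by fun_prop)

lemma measurableSet_conf {d : ℕ} (r : ℝ) (k : ℕ) {A : Set (Euc d)} (hA : MeasurableSet A) :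
    MeasurableSet (conf r k A) := by
  have h := measurableSet_conf_family (T := Unit) r k (A := Prod.snd ⁻¹' A) (measurable_snd hA)
  exact (measurable_prodMk_left (x := ())) h

lemma measurable_ZE_family {d : ℕ} {T : Type*} [MeasurableSpace T] (r : ℝ) (l : ℝ≥0∞)
    {A : Set (T × Euc d)} (hA : MeasurableSet A) :
    Measurable fun t => ZE r l {x | (t, x) ∈ A} := by
  refine Measurable.tsum fun k => Measurable.const_mul ?_ _
  exact measurable_measure_prodMk_left (measurableSet_conf_family r k hA)

lemma volume_conf_le {d : ℕ} (r : ℝ) (k : ℕ) (A : Set (Euc d)) :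
    volume (conf r k A) ≤ volume A ^ k := by
  calc volume (conf r k A) ≤ volume (Set.univ.pi fun _ : Fin k => A) :=
        measure_mono fun x hx j _ => hx.1 j
    _ = volume A ^ k := by
        rw [volume_pi, Measure.pi_pi]; simp

lemma ZE_lt_top {d : ℕ} (r : ℝ) (l : NNReal) {A : Set (Euc d)} (hA : volume A ≠ ∞) :
    ZE r l A ≠ ∞ := by
  lift volume A to NNReal using hA with a ha
  have hs : Summable fun k : ℕ => (l * a) ^ k / (Nat.factorial k : NNReal) := by
    rw [← NNReal.summable_coe]
    simpa using Real.summable_pow_div_factorial ((l : ℝ) * a)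
  refine ne_top_of_le_ne_top (ENNReal.tsum_coe_ne_top_iff_summable.2 hs)
    (ENNReal.tsum_le_tsum fun k => ?_)
  rw [ENNReal.coe_div (by positivity), ENNReal.coe_pow, ENNReal.coe_mul, mul_pow,
    ENNReal.coe_natCast, ENNReal.mul_div_right_comm, ha]
  exact mul_le_mul_right (volume_conf_le r k A) _

lemma one_le_ZE {d : ℕ} (r : ℝ) (l : ℝ≥0∞) (A : Set (Euc d)) : 1 ≤ ZE r l A := by
  refine le_trans ?_ (ENNReal.le_tsum 0)
  have : conf r 0 A = Set.univ := by ext x; simp [conf]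
  rw [this]
  simp [volume_pi]

lemma ZE_empty {d : ℕ} (r : ℝ) (l : ℝ≥0∞) : ZE r l (∅ : Set (Euc d)) = 1 := by
  rw [ZE, tsum_eq_single 0]
  · have : conf r 0 (∅ : Set (Euc d)) = Set.univ := by ext x; simp [conf]
    rw [this]
    simp [volume_pi]
  · intro k hk
    have : conf r k (∅ : Set (Euc d)) = ∅ := by
      ext x
      simp only [conf, Set.mem_empty_iff_false, Set.mem_ofPred_eq, iff_false, not_and]
      intro h
      exact (h ⟨0, Nat.pos_of_ne_zero hk⟩).elim
    simp [this]

/-- Integrating out the `i`-th point of a configuration. -/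
lemma volume_conf_pinned {d : ℕ} (r : ℝ) (k : ℕ) (i : Fin (k + 1)) {S B : Set (Euc d)}
    (hS : MeasurableSet S) (hB : MeasurableSet B) :
    volume {x : Fin (k + 1) → Euc d | x i ∈ S ∧ (∀ j, x (i.succAbove j) ∈ B) ∧
      ∀ a b, a ≠ b → r ≤ dist (x a) (x b)} =
    ∫⁻ w in S, volume (conf r k {x ∈ B | r ≤ dist x w}) := by
  have hfam : MeasurableSet {p : Euc d × Euc d | p.2 ∈ B ∧ r ≤ dist p.2 p.1} :=
    (measurable_snd hB).inter (measurableSet_le measurable_const (measurable_snd.dist measurable_fst))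
  have hm := measurableSet_conf_family r k hfam
  set Q : Set (Euc d × (Fin k → Euc d)) :=
    {p | p.1 ∈ S ∧ p.2 ∈ conf r k {x | x ∈ B ∧ r ≤ dist x p.1}} with hQ
  have hQm : MeasurableSet Q := (measurable_fst hS).inter hm
  have key := (volume_preserving_piFinSuccAbove (fun _ : Fin (k + 1) => Euc d) i).measure_preimage
    hQm.nullMeasurableSet
  have hset : (MeasurableEquiv.piFinSuccAbove (fun _ : Fin (k + 1) => Euc d) i) ⁻¹' Q =
      {x : Fin (k + 1) → Euc d | x i ∈ S ∧ (∀ j, x (i.succAbove j) ∈ B) ∧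
      ∀ a b, a ≠ b → r ≤ dist (x a) (x b)} := by
    ext x
    simp only [hQ, conf, Set.mem_preimage, Set.mem_ofPred_eq]
    change (x i ∈ S ∧ (∀ j, x (i.succAbove j) ∈ B ∧ r ≤ dist (x (i.succAbove j)) (x i)) ∧
      ∀ a b, a ≠ b → r ≤ dist (x (i.succAbove a)) (x (i.succAbove b))) ↔ _
    constructor
    · rintro ⟨h1, h2, h3⟩
      refine ⟨h1, fun j => (h2 j).1, ?_⟩
      rw [i.forall_iff_succAbove]
      constructor
      · rw [i.forall_iff_succAbove]
        exact ⟨fun h => (h rfl).elim, fun j _ => by rw [dist_comm]; exact (h2 j).2⟩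
      · intro a
        rw [i.forall_iff_succAbove]
        exact ⟨fun _ => (h2 a).2, fun b hab => h3 a b fun h => hab (by rw [h])⟩
    · rintro ⟨h1, h2, h3⟩
      refine ⟨h1, fun j => ⟨h2 j, h3 _ _ (Fin.succAbove_ne i j)⟩, fun a b hab => h3 _ _ ?_⟩
      exact fun h => hab (Fin.succAbove_right_injective h)
  rw [← hset, key, Measure.volume_eq_prod, Measure.prod_apply hQm, ← lintegral_indicator hS]
  refine lintegral_congr fun w => ?_
  by_cases hw : w ∈ S
  · simp [hQ, hw]
  · simp [hQ, hw]

lemma volume_conf_succ_le {d : ℕ} (r : ℝ) (k : ℕ) {A S : Set (Euc d)}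
    (hA : MeasurableSet A) (hS : MeasurableSet S) :
    volume (conf r (k + 1) A) ≤ volume (conf r (k + 1) (A \ S)) +
      (k + 1) * ∫⁻ w in S, volume (conf r k {x ∈ A | r ≤ dist x w}) := by
  have hsub : conf r (k + 1) A ⊆ conf r (k + 1) (A \ S) ∪
      ⋃ i : Fin (k + 1), {x : Fin (k + 1) → Euc d | x i ∈ S ∧ (∀ j, x (i.succAbove j) ∈ A) ∧
      ∀ a b, a ≠ b → r ≤ dist (x a) (x b)} := by
    intro x hx
    by_cases h : ∃ i, x i ∈ S
    · obtain ⟨i, hi⟩ := h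
      exact Or.inr (Set.mem_iUnion.2 ⟨i, hi, fun j => hx.1 _, hx.2⟩)
    · push Not at h
      exact Or.inl ⟨fun j => ⟨hx.1 j, h j⟩, hx.2⟩
  refine (measure_mono hsub).trans ((measure_union_le _ _).trans ?_)
  gcongr
  refine (measure_iUnion_fintype_le _ _).trans ?_
  simp_rw [volume_conf_pinned r k _ hS hA]
  simp

lemma le_volume_conf_succ {d : ℕ} (r : ℝ) (k : ℕ) {A S : Set (Euc d)}
    (hA : MeasurableSet A) (hS : MeasurableSet S) (hSA : S ⊆ A) :
    volume (conf r (k + 1) (A \ S)) +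
      (k + 1) * ∫⁻ w in S, volume (conf r k {x ∈ A \ S | r ≤ dist x w}) ≤
    volume (conf r (k + 1) A) := by
  set P : Fin (k + 1) → Set (Fin (k + 1) → Euc d) := fun i =>
    {x | x i ∈ S ∧ (∀ j, x (i.succAbove j) ∈ A \ S) ∧ ∀ a b, a ≠ b → r ≤ dist (x a) (x b)} with hP
  have hPm : ∀ i, MeasurableSet (P i) := by
    intro i
    have : P i = (fun x => x i) ⁻¹' S ∩ ((⋂ j, (fun x => x (i.succAbove j)) ⁻¹' (A \ S)) ∩
        conf r (k + 1) Set.univ) := by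
      ext x; simp [hP, conf]
    rw [this]
    exact (measurable_pi_apply i hS).inter ((MeasurableSet.iInter fun j =>
      measurable_pi_apply (i.succAbove j) (hA.diff hS)).inter (measurableSet_conf r _ MeasurableSet.univ))
  have hdisj : Pairwise (Function.onFun Disjoint P) := by
    intro i j hij
    refine Set.disjoint_left.2 fun x hi hj => ?_
    obtain ⟨m, hm⟩ := Fin.exists_succAbove_eq hij
    have := hj.2.1 m
    rw [hm] at this
    exact this.2 hi.1
  have hdisj2 : Disjoint (conf r (k + 1) (A \ S)) (⋃ i, P i) := by
    refine Set.disjoint_left.2 fun x hx hu => ?_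
    obtain ⟨i, hi⟩ := Set.mem_iUnion.1 hu
    exact (hx.1 i).2 hi.1
  have hsub : conf r (k + 1) (A \ S) ∪ ⋃ i, P i ⊆ conf r (k + 1) A := by
    rintro x (hx | hx)
    · exact conf_mono r _ Set.sdiff_subset hx
    · obtain ⟨i, hi⟩ := Set.mem_iUnion.1 hx
      exact ⟨(i.forall_iff_succAbove).2 ⟨hSA hi.1, fun j => (hi.2.1 j).1⟩, hi.2.2⟩
  refine le_trans (le_of_eq ?_) (measure_mono hsub)
  rw [measure_union hdisj2 (MeasurableSet.iUnion hPm), measure_iUnion hdisj hPm, tsum_fintype]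
  simp_rw [hP, volume_conf_pinned r k _ hS (hA.diff hS)]
  simp

lemma factorial_coeff (l : NNReal) (k : ℕ) (c : ℝ≥0∞) :
    (l : ℝ≥0∞) ^ (k + 1) / (Nat.factorial (k + 1) : ℝ≥0∞) * ((k + 1) * c) =
      l * ((l : ℝ≥0∞) ^ k / (Nat.factorial k : ℝ≥0∞) * c) := by
  have h1 : ((k : ℝ≥0∞) + 1) ≠ 0 := by positivity
  have h2 : ((k : ℝ≥0∞) + 1) ≠ ∞ := by finiteness
  rw [Nat.factorial_succ, Nat.cast_mul, Nat.cast_add, Nat.cast_one, pow_succ, div_eq_mul_inv,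
    ENNReal.mul_inv (Or.inl h1) (Or.inl h2), div_eq_mul_inv]
  calc _ = (l : ℝ≥0∞) * (l ^ k * (Nat.factorial k : ℝ≥0∞)⁻¹ * c) *
        (((k : ℝ≥0∞) + 1)⁻¹ * (k + 1)) := by
        ring
    _ = _ := by rw [ENNReal.inv_mul_cancel h1 h2, mul_one]

lemma lintegral_ZE {d : ℕ} (r : ℝ) (l : ℝ≥0∞) {S B : Set (Euc d)} (hB : MeasurableSet B) :
    ∫⁻ w in S, ZE r l {x ∈ B | r ≤ dist x w} =
      ∑' k : ℕ, l ^ k / (Nat.factorial k : ℝ≥0∞) *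
        ∫⁻ w in S, volume (conf r k {x ∈ B | r ≤ dist x w}) := by
  have hfam : MeasurableSet {p : Euc d × Euc d | p.2 ∈ B ∧ r ≤ dist p.2 p.1} :=
    (measurable_snd hB).inter (measurableSet_le measurable_const (measurable_snd.dist measurable_fst))
  have hm : ∀ k, Measurable fun w => volume (conf r k {x ∈ B | r ≤ dist x w}) := fun k =>
    measurable_measure_prodMk_left (measurableSet_conf_family r k hfam)
  unfold ZE
  rw [lintegral_tsum fun k => ((hm k).const_mul _).aemeasurable]
  exact tsum_congr fun k => lintegral_const_mul _ (hm k)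

lemma ZE_eq_zero_add {d : ℕ} (r : ℝ) (l : ℝ≥0∞) (A : Set (Euc d)) :
    ZE r l A = 1 + ∑' k : ℕ, l ^ (k + 1) / (Nat.factorial (k + 1) : ℝ≥0∞) *
      volume (conf r (k + 1) A) := by
  have : conf r 0 A = Set.univ := by ext x; simp [conf]
  rw [ZE, tsum_eq_zero_add' ENNReal.summable, this]
  simp [volume_pi]

lemma ZE_le {d : ℕ} (r : ℝ) (l : NNReal) {A S : Set (Euc d)}
    (hA : MeasurableSet A) (hS : MeasurableSet S) :
    ZE r l A ≤ ZE r l (A \ S) + l * ∫⁻ w in S, ZE r l {x ∈ A | r ≤ dist x w} := by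
  rw [lintegral_ZE r l hA, ZE_eq_zero_add r l A, ZE_eq_zero_add r l (A \ S), add_assoc,
    ← ENNReal.tsum_mul_left, ← ENNReal.tsum_add]
  gcongr with k
  rw [← factorial_coeff, ← mul_add]
  gcongr
  exact volume_conf_succ_le r k hA hS

lemma le_ZE {d : ℕ} (r : ℝ) (l : NNReal) {A S : Set (Euc d)}
    (hA : MeasurableSet A) (hS : MeasurableSet S) (hSA : S ⊆ A) :
    ZE r l (A \ S) + l * ∫⁻ w in S, ZE r l {x ∈ A \ S | r ≤ dist x w} ≤ ZE r l A := by
  rw [lintegral_ZE r l (hA.diff hS), ZE_eq_zero_add r l A, ZE_eq_zero_add r l (A \ S), add_assoc,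
    ← ENNReal.tsum_mul_left, ← ENNReal.tsum_add]
  gcongr with k
  rw [← factorial_coeff, ← mul_add]
  gcongr
  exact le_volume_conf_succ r k hA hS hSA

/-- A function whose increments are quadratically small in those of a continuous function is
constant. -/
lemma eq_of_abs_sub_le_sq {D N : ℝ → ℝ} {C : ℝ} (hN : Continuous N)
    (h : ∀ s t, |D s - D t| ≤ C * (N s - N t) ^ 2) (s t : ℝ) : D s = D t := by
  have hpart : ∀ n : ℕ, 0 < n → |D s - D t| ≤ C * (N s - N t) ^ 2 / n := by
    intro n hn
    have hn' : (0 : ℝ) < n := by exact_mod_cast hn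
    have hex : ∀ k : ℕ, ∃ u, k ≤ n → N u = N t + k / n * (N s - N t) := by
      intro k
      by_cases hk : k ≤ n
      · have hk' : (k : ℝ) / n ∈ Set.Icc (0 : ℝ) 1 :=
          ⟨by positivity, (div_le_one hn').2 (by exact_mod_cast hk)⟩
        have hmem : N t + k / n * (N s - N t) ∈ Set.uIcc (N t) (N s) := by
          rw [← segment_eq_uIcc, segment_eq_image']
          exact ⟨k / n, hk', rfl⟩
        obtain ⟨u, -, hu⟩ := intermediate_value_uIcc hN.continuousOn hmem
        exact ⟨u, fun _ => hu⟩
      · exact ⟨0, fun h => (hk h).elim⟩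
    choose u hu using hex
    have hC : ∀ x y, N x = N y → D x = D y := by
      intro x y hxy
      have := h x y
      rw [hxy] at this
      simp only [sub_self] at this
      have h0 : |D x - D y| ≤ 0 := by simpa using this
      exact sub_eq_zero.1 (abs_nonpos_iff.1 h0)
    have e0 : D (u 0) = D t := hC _ _ (by rw [hu 0 (by lia)]; simp)
    have en : D (u n) = D s := hC _ _ (by rw [hu n le_rfl]; field_simp; ring)
    have hstep := dist_le_range_sum_of_dist_le (f := fun k => D (u k)) n
      (d := fun _ => C * ((N s - N t) / n) ^ 2) (fun {k} hk => by
        rw [Real.dist_eq]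
        refine (h _ _).trans (le_of_eq ?_)
        rw [hu k hk.le, hu (k + 1) hk]
        push_cast
        field_simp
        ring)
    rw [e0, en, dist_comm, Real.dist_eq] at hstep
    refine hstep.trans (le_of_eq ?_)
    simp only [Finset.sum_const, Finset.card_range, nsmul_eq_mul]
    field_simp
  have hlim : Tendsto (fun n : ℕ => C * (N s - N t) ^ 2 / (n : ℝ)) atTop (𝓝 0) :=
    tendsto_const_div_atTop_nhds_zero_nat _
  have h0 : |D s - D t| ≤ 0 := ge_of_tendsto hlim
    ((eventually_gt_atTop 0).mono fun n hn => hpart n hn)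
  exact sub_eq_zero.1 (abs_nonpos_iff.1 h0)

/-- The real partition function. -/
def ZR {d : ℕ} (r : ℝ) (l : NNReal) (A : Set (Euc d)) : ℝ := (ZE r l A).toReal

/-- The one-point density `λ Z(A \ B(v, r)) / Z(A)`. -/
def dens {d : ℕ} (r : ℝ) (l : NNReal) (A : Set (Euc d)) (v : Euc d) : ℝ :=
  l * (ZR r l {x ∈ A | r ≤ dist x v} / ZR r l A)

section
variable {d : ℕ} {r : ℝ} {l : NNReal} {A B : Set (Euc d)}

lemma ZR_nonneg (A : Set (Euc d)) : 0 ≤ ZR r l A := ENNReal.toReal_nonneg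

lemma one_le_ZR (hA : volume A ≠ ∞) : 1 ≤ ZR r l A := by
  have := ENNReal.toReal_mono (ZE_lt_top r l hA) (one_le_ZE r l A)
  simpa [ZR] using this

lemma ZR_mono (hB : volume B ≠ ∞) (h : A ⊆ B) : ZR r l A ≤ ZR r l B :=
  ENNReal.toReal_mono (ZE_lt_top r l hB) (ZE_mono r l h)

lemma ZR_empty : ZR r l (∅ : Set (Euc d)) = 1 := by simp [ZR, ZE_empty]

lemma volume_ne_top_of_subset (hB : volume B ≠ ∞) (h : A ⊆ B) : volume A ≠ ∞ :=
  measure_ne_top_of_subset h hB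

lemma measurable_ZR_family {T : Type*} [MeasurableSpace T]
    {F : Set (T × Euc d)} (hF : MeasurableSet F) :
    Measurable fun t => ZR r l {x | (t, x) ∈ F} :=
  (measurable_ZE_family r l hF).ennreal_toReal

lemma measurable_dens_family {T : Type*} [MeasurableSpace T]
    {F : Set (T × Euc d)} (hF : MeasurableSet F) {v : T → Euc d} (hv : Measurable v) :
    Measurable fun t => dens r l {x | (t, x) ∈ F} (v t) := by
  have h2 : MeasurableSet {p : T × Euc d | p ∈ F ∧ r ≤ dist p.2 (v p.1)} :=
    hF.inter (measurableSet_le measurable_const (measurable_snd.dist (hv.comp measurable_fst)))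
  exact ((measurable_ZR_family h2).div (measurable_ZR_family hF)).const_mul _

lemma dens_nonneg (A : Set (Euc d)) (v : Euc d) : 0 ≤ dens r l A v :=
  mul_nonneg l.2 (div_nonneg (ZR_nonneg _) (ZR_nonneg _))

lemma dens_le (hA : volume A ≠ ∞) (v : Euc d) : dens r l A v ≤ l := by
  have h1 : (0 : ℝ) < ZR r l A := zero_lt_one.trans_le (one_le_ZR hA)
  have h2 : ZR r l {x ∈ A | r ≤ dist x v} / ZR r l A ≤ 1 :=
    (div_le_one h1).2 (ZR_mono hA fun x hx => hx.1)
  exact mul_le_of_le_one_right l.2 h2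

lemma measurable_ZR_remove (hB : MeasurableSet B) :
    Measurable fun w => ZR r l {x ∈ B | r ≤ dist x w} := by
  have hfam : MeasurableSet {p : Euc d × Euc d | p.2 ∈ B ∧ r ≤ dist p.2 p.1} :=
    (measurable_snd hB).inter (measurableSet_le measurable_const
      (measurable_snd.dist measurable_fst))
  exact measurable_ZR_family (F := {p : Euc d × Euc d | p.2 ∈ B ∧ r ≤ dist p.2 p.1}) hfam

lemma toReal_lintegral_ZE {S : Set (Euc d)} (hB : MeasurableSet B) (hB' : volume B ≠ ∞) :
    (∫⁻ w in S, ZE r l {x ∈ B | r ≤ dist x w}).toReal =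
      ∫ w in S, ZR r l {x ∈ B | r ≤ dist x w} := by
  have hfam : MeasurableSet {p : Euc d × Euc d | p.2 ∈ B ∧ r ≤ dist p.2 p.1} :=
    (measurable_snd hB).inter (measurableSet_le measurable_const
      (measurable_snd.dist measurable_fst))
  refine (integral_toReal (measurable_ZE_family r l hfam).aemeasurable ?_).symm
  exact Eventually.of_forall fun w =>
    (ZE_lt_top r l (volume_ne_top_of_subset hB' fun x hx => hx.1)).lt_top

lemma integrableOn_ZR_remove {S : Set (Euc d)} (hS : volume S ≠ ∞)
    (hB : MeasurableSet B) (hB' : volume B ≠ ∞) :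
    IntegrableOn (fun w => ZR r l {x ∈ B | r ≤ dist x w}) S := by
  refine IntegrableOn.of_bound hS.lt_top (measurable_ZR_remove hB).aestronglyMeasurable
    (ZR r l B) (Eventually.of_forall fun w => ?_)
  rw [Real.norm_of_nonneg (ZR_nonneg _)]
  exact ZR_mono hB' fun x hx => hx.1

lemma lintegral_ZE_ne_top {S : Set (Euc d)} (hS : volume S ≠ ∞) (hB' : volume B ≠ ∞) :
    ∫⁻ w in S, ZE r l {x ∈ B | r ≤ dist x w} ≠ ∞ := by
  refine ne_top_of_le_ne_top (b := ZE r l B * volume S) ?_ ?_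
  · exact ENNReal.mul_ne_top (ZE_lt_top r l hB') hS
  · rw [← setLIntegral_const]
    exact lintegral_mono fun w => ZE_mono r l fun x hx => hx.1

lemma ZR_le {S : Set (Euc d)} (hA : MeasurableSet A) (hA' : volume A ≠ ∞)
    (hS : MeasurableSet S) (hSA : S ⊆ A) :
    ZR r l A ≤ ZR r l (A \ S) + l * ∫ w in S, ZR r l {x ∈ A | r ≤ dist x w} := by
  have hS' := volume_ne_top_of_subset hA' hSA
  have h1 := ZE_lt_top r l (volume_ne_top_of_subset hA' (Set.sdiff_subset (t := S)))
  have h2 := lintegral_ZE_ne_top (r := r) (l := l) hS' hA'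
  have h3 := ENNReal.mul_ne_top (ENNReal.coe_ne_top (r := l)) h2
  have := ENNReal.toReal_mono (ENNReal.add_ne_top.2 ⟨h1, h3⟩) (ZE_le r l hA hS)
  rwa [ENNReal.toReal_add h1 h3, ENNReal.toReal_mul, toReal_lintegral_ZE hA hA'] at this

lemma le_ZR {S : Set (Euc d)} (hA : MeasurableSet A) (hA' : volume A ≠ ∞)
    (hS : MeasurableSet S) (hSA : S ⊆ A) :
    ZR r l (A \ S) + l * ∫ w in S, ZR r l {x ∈ A \ S | r ≤ dist x w} ≤ ZR r l A := by
  have hS' := volume_ne_top_of_subset hA' hSA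
  have hAS := volume_ne_top_of_subset hA' (Set.sdiff_subset (t := S))
  have h1 := ZE_lt_top r l hAS
  have h2 := lintegral_ZE_ne_top (r := r) (l := l) hS' hAS
  have h3 := ENNReal.mul_ne_top (ENNReal.coe_ne_top (r := l)) h2
  have := ENNReal.toReal_mono (ZE_lt_top r l hA') (le_ZE r l hA hS hSA)
  rwa [ENNReal.toReal_add h1 h3, ENNReal.toReal_mul,
    toReal_lintegral_ZE (hA.diff hS) hAS] at this

lemma ZR_sub_le {S : Set (Euc d)} (hA : MeasurableSet A) (hA' : volume A ≠ ∞)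
    (hS : MeasurableSet S) (hS' : volume S ≠ ∞) :
    ZR r l A - ZR r l (A \ S) ≤ l * ZR r l A * volume.real S := by
  have h := ZR_le (r := r) (l := l) hA hA' (hA.inter hS) Set.inter_subset_left
  rw [Set.sdiff_self_inter] at h
  have h0 : (0 : ℝ) ≤ ZR r l A := ZR_nonneg _
  have hi : volume (A ∩ S) ≠ ∞ := volume_ne_top_of_subset hA' Set.inter_subset_left
  have h2 : ∫ w in A ∩ S, ZR r l {x ∈ A | r ≤ dist x w} ≤ ZR r l A * volume.real S := by
    calc ∫ w in A ∩ S, ZR r l {x ∈ A | r ≤ dist x w} ≤ ∫ w in A ∩ S, ZR r l A :=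
          setIntegral_mono (integrableOn_ZR_remove hi hA hA') (integrableOn_const hi)
            fun w => ZR_mono hA' fun x hx => hx.1
      _ = ZR r l A * volume.real (A ∩ S) := by rw [setIntegral_const, smul_eq_mul, mul_comm]
      _ ≤ _ := mul_le_mul_of_nonneg_left
        (ENNReal.toReal_mono hS' (measure_mono Set.inter_subset_right)) h0
  have := mul_le_mul_of_nonneg_left h2 l.2
  have e : (l : ℝ) * (ZR r l A * volume.real S) = l * ZR r l A * volume.real S := by ring
  change (l : ℝ) * _ ≤ (l : ℝ) * _ at this
  linarith

end

section
variable {d : ℕ} {r : ℝ} {l : NNReal} {A : Set (Euc d)} {f : Euc d → ℝ}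

lemma measurable_dens_level (hA : MeasurableSet A) (hf : Measurable f) :
    Measurable fun w => dens r l {x ∈ A | f w ≤ f x} w := by
  have hfam : MeasurableSet {p : Euc d × Euc d | p.2 ∈ A ∧ f p.1 ≤ f p.2} :=
    (measurable_snd hA).inter (measurableSet_le (hf.comp measurable_fst) (hf.comp measurable_snd))
  exact measurable_dens_family hfam measurable_id

lemma integrableOn_dens_level {S : Set (Euc d)} (hA : MeasurableSet A) (hA' : volume A ≠ ∞)
    (hf : Measurable f) (hS : volume S ≠ ∞) :
    IntegrableOn (fun w => dens r l {x ∈ A | f w ≤ f x} w) S := by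
  refine IntegrableOn.of_bound hS.lt_top (measurable_dens_level hA hf).aestronglyMeasurable
    l (Eventually.of_forall fun w => ?_)
  rw [Real.norm_of_nonneg (dens_nonneg _ _)]
  exact dens_le (volume_ne_top_of_subset hA' fun x hx => hx.1) w

lemma abs_log_sub_integral_le (hA : MeasurableSet A) (hA' : volume A ≠ ∞)
    (hf : Measurable f) {t s : ℝ} (hts : t ≤ s) :
    |Real.log (ZR r l {x ∈ A | t ≤ f x}) - Real.log (ZR r l {x ∈ A | s ≤ f x}) -
      ∫ w in {x ∈ A | t ≤ f x ∧ f x < s}, dens r l {x ∈ A | f w ≤ f x} w| ≤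
    2 * (l : ℝ) ^ 2 * ZR r l A ^ 2 * volume.real {x ∈ A | t ≤ f x ∧ f x < s} ^ 2 := by
  have hmt : ∀ u, MeasurableSet {x ∈ A | u ≤ f x} := fun u =>
    hA.inter (measurableSet_le measurable_const hf)
  have hvt : ∀ u, volume {x ∈ A | u ≤ f x} ≠ ∞ := fun u =>
    volume_ne_top_of_subset hA' fun x hx => hx.1
  set S := {x ∈ A | t ≤ f x ∧ f x < s} with hSdef
  have hSm : MeasurableSet S := hA.inter ((measurableSet_le measurable_const hf).inter
    (measurableSet_lt hf measurable_const))
  have hSA : S ⊆ {x ∈ A | t ≤ f x} := fun x hx => ⟨hx.1, hx.2.1⟩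
  have hS' : volume S ≠ ∞ := volume_ne_top_of_subset (hvt t) hSA
  have hdiff : {x ∈ A | t ≤ f x} \ S = {x ∈ A | s ≤ f x} := by
    ext x
    simp only [hSdef, Set.mem_sdiff, Set.mem_ofPred_eq, not_and, not_lt]
    exact ⟨fun h => ⟨h.1.1, h.2 h.1.1 h.1.2⟩, fun h => ⟨⟨h.1, hts.trans h.2⟩, fun _ _ => h.2⟩⟩
  set a := ZR r l {x ∈ A | t ≤ f x} with ha
  set b := ZR r l {x ∈ A | s ≤ f x} with hb
  set Q := ZR r l A with hQ
  set η := volume.real S with hη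
  have hη0 : 0 ≤ η := measureReal_nonneg
  have hl0 : (0 : ℝ) ≤ l := l.2
  have hb1 : 1 ≤ b := one_le_ZR (hvt s)
  have hab : b ≤ a := ZR_mono (hvt t) fun x hx => ⟨hx.1, hts.trans hx.2⟩
  have haQ : a ≤ Q := ZR_mono hA' fun x hx => hx.1
  have hub := ZR_le (r := r) (l := l) (hmt t) (hvt t) hSm hSA
  have hlb := le_ZR (r := r) (l := l) (hmt t) (hvt t) hSm hSA
  have habη := ZR_sub_le (r := r) (l := l) (hmt t) (hvt t) hSm hS'
  rw [hdiff, ← ha, ← hb] at hub hlb habη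
  set U : Euc d → ℝ := fun w => ZR r l {x ∈ {x ∈ A | t ≤ f x} | r ≤ dist x w} with hU
  set W : Euc d → ℝ := fun w => ZR r l {x ∈ {x ∈ A | s ≤ f x} | r ≤ dist x w} with hW
  set D : Euc d → ℝ := fun w => dens r l {x ∈ A | f w ≤ f x} w with hD
  have hUi : IntegrableOn U S := integrableOn_ZR_remove hS' (hmt t) (hvt t)
  have hWi : IntegrableOn W S := integrableOn_ZR_remove hS' (hmt s) (hvt s)
  have hDi : IntegrableOn D S := integrableOn_dens_level hA hA' hf hS'
  have hci : ∀ c : ℝ, IntegrableOn (fun _ => c) S := fun c => integrableOn_const hS'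
  have ha0 : 0 < a := by linarith
  have hb0 : 0 < b := by linarith
  have hab' : a - b ≤ l * Q * η := by
    refine habη.trans ?_
    gcongr
  have hW0 : ∀ w, 0 ≤ W w := fun w => ZR_nonneg _
  have hUQ : ∀ w, U w ≤ Q := fun w => ZR_mono hA' fun x hx => hx.1.1
  have hWU : ∀ w, W w ≤ U w := fun w =>
    ZR_mono (volume_ne_top_of_subset (hvt t) fun x hx => hx.1)
      fun x hx => ⟨⟨hx.1.1, hts.trans hx.1.2⟩, hx.2⟩
  have hUW : ∀ w, U w - W w ≤ l * Q * η := by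
    intro w
    have hm : MeasurableSet {x ∈ {x ∈ A | t ≤ f x} | r ≤ dist x w} :=
      (hmt t).inter (measurableSet_le measurable_const (measurable_id.dist measurable_const))
    have hv : volume {x ∈ {x ∈ A | t ≤ f x} | r ≤ dist x w} ≠ ∞ :=
      volume_ne_top_of_subset (hvt t) fun x hx => hx.1
    have h := ZR_sub_le (r := r) (l := l) hm hv hSm hS'
    have e : {x ∈ {x ∈ A | t ≤ f x} | r ≤ dist x w} \ S =
        {x ∈ {x ∈ A | s ≤ f x} | r ≤ dist x w} := by
      rw [← hdiff]
      ext x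
      simp only [Set.mem_sdiff, Set.mem_ofPred_eq]
      tauto
    rw [e] at h
    refine h.trans ?_
    gcongr
    exact hUQ w
  have hgap : ∀ w, U w / b - W w / a ≤ 2 * l * Q ^ 2 * η := by
    intro w
    have e : U w / b - W w / a = (a * (U w - W w) + (a - b) * W w) / (a * b) := by
      field_simp
      ring
    rw [e]
    have hnum : a * (U w - W w) + (a - b) * W w ≤ 2 * l * Q ^ 2 * η := by
      have h1 : a * (U w - W w) ≤ Q * (l * Q * η) :=
        mul_le_mul haQ (hUW w) (by linarith [hWU w]) (by linarith)
      have h2 : (a - b) * W w ≤ (l * Q * η) * Q :=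
        mul_le_mul hab' ((hWU w).trans (hUQ w)) (hW0 w) (by linarith)
      linarith
    have hnn : 0 ≤ a * (U w - W w) + (a - b) * W w :=
      add_nonneg (mul_nonneg ha0.le (by linarith [hWU w])) (mul_nonneg (by linarith) (hW0 w))
    refine (div_le_self hnn ?_).trans hnum
    nlinarith
  have hDU : ∀ w ∈ S, D w ≤ l * (U w / b) := by
    intro w hw
    refine mul_le_mul_of_nonneg_left ?_ hl0
    have h1 : ZR r l {x ∈ {x ∈ A | f w ≤ f x} | r ≤ dist x w} ≤ U w :=
      ZR_mono (volume_ne_top_of_subset (hvt t) fun x hx => hx.1)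
        fun x hx => ⟨⟨hx.1.1, hw.2.1.trans hx.1.2⟩, hx.2⟩
    have h2 : b ≤ ZR r l {x ∈ A | f w ≤ f x} :=
      ZR_mono (hvt _) fun x hx => ⟨hx.1, hw.2.2.le.trans hx.2⟩
    exact div_le_div₀ (ZR_nonneg _) h1 hb0 h2
  have hDW : ∀ w ∈ S, l * (W w / a) ≤ D w := by
    intro w hw
    refine mul_le_mul_of_nonneg_left ?_ hl0
    have h1 : W w ≤ ZR r l {x ∈ {x ∈ A | f w ≤ f x} | r ≤ dist x w} :=
      ZR_mono (volume_ne_top_of_subset (hvt (f w)) fun x hx => hx.1)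
        fun x hx => ⟨⟨hx.1.1, hw.2.2.le.trans hx.1.2⟩, hx.2⟩
    have h2 : ZR r l {x ∈ A | f w ≤ f x} ≤ a :=
      ZR_mono (hvt _) fun x hx => ⟨hx.1, hw.2.1.trans hx.2⟩
    exact div_le_div₀ (ZR_nonneg _) h1 (by linarith [one_le_ZR (r := r) (l := l) (hvt (f w))]) h2
  have hIU : ∫ w in S, l * (U w / b) ≤ ∫ w in S, D w + 2 * l ^ 2 * Q ^ 2 * η ∂volume := by
    refine setIntegral_mono_on ((hUi.div_const b).const_mul _) (hDi.add (hci _)) hSm fun w hw => ?_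
    have h1 := mul_le_mul_of_nonneg_left (hgap w) hl0
    have h2 := hDW w hw
    nlinarith
  have hIW : ∫ w in S, D w - 2 * l ^ 2 * Q ^ 2 * η ∂volume ≤ ∫ w in S, l * (W w / a) := by
    refine setIntegral_mono_on (hDi.sub (hci _)) ((hWi.div_const a).const_mul _) hSm fun w hw => ?_
    have h1 := mul_le_mul_of_nonneg_left (hgap w) hl0
    have h2 := hDU w hw
    nlinarith
  rw [integral_add hDi (hci _), setIntegral_const, smul_eq_mul, ← hη, integral_const_mul,
    integral_div] at hIU
  rw [integral_sub hDi (hci _), setIntegral_const, smul_eq_mul, ← hη, integral_const_mul,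
    integral_div] at hIW
  have hlog1 : Real.log a - Real.log b ≤ (a - b) / b := by
    rw [← Real.log_div ha0.ne' hb0.ne', sub_div, div_self hb0.ne']
    exact Real.log_le_sub_one_of_pos (div_pos ha0 hb0)
  have hlog2 : (a - b) / a ≤ Real.log a - Real.log b := by
    have := Real.log_le_sub_one_of_pos (div_pos hb0 ha0)
    rw [Real.log_div hb0.ne' ha0.ne'] at this
    rw [sub_div, div_self ha0.ne']
    linarith
  have h3 : (a - b) / b ≤ l * ((∫ w in S, U w) / b) := by
    rw [← mul_div_assoc]
    gcongr
    linarith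
  have h4 : l * ((∫ w in S, W w) / a) ≤ (a - b) / a := by
    rw [← mul_div_assoc]
    gcongr
    linarith
  rw [abs_le]
  constructor <;> nlinarith

lemma continuous_volume_sublevel (hA : volume A ≠ ∞) (hf : Measurable f)
    (hnull : ∀ c, volume {x | f x = c} = 0) :
    Continuous fun s => ∫ x in A, {x | f x < s}.indicator (fun _ => (1 : ℝ)) x := by
  have : IsFiniteMeasure (volume.restrict A) := ⟨by simpa using hA.lt_top⟩
  refine continuous_iff_continuousAt.2 fun s => continuousAt_of_dominated (bound := fun _ => 1)
    (Eventually.of_forall fun u => ?_) (Eventually.of_forall fun u => Eventually.of_forall fun x => ?_)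
    (integrable_const _) ?_
  · exact (measurable_const.indicator (measurableSet_lt hf measurable_const)).aestronglyMeasurable
  · by_cases h : f x < u <;> simp [h]
  · have h0 : ∀ᵐ x ∂(volume.restrict A), f x ≠ s :=
      ae_restrict_of_ae (by simpa [ae_iff] using hnull s)
    filter_upwards [h0] with x hx
    rcases lt_or_gt_of_ne hx with h | h
    · refine (continuousAt_const (y := (1 : ℝ))).congr ?_
      filter_upwards [lt_mem_nhds h] with u hu
      simp [hu]
    · refine (continuousAt_const (y := (0 : ℝ))).congr ?_
      filter_upwards [gt_mem_nhds h] with u hu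
      simp [hu.le]

/-- Removing points from `A` in the order given by `f` expresses `log Z` as an integral of
densities. -/
theorem log_ZR_sub (hA : MeasurableSet A) (hA' : volume A ≠ ∞) (hf : Measurable f)
    (hnull : ∀ c, volume {x | f x = c} = 0) {t s : ℝ} (hts : t ≤ s) :
    Real.log (ZR r l {x ∈ A | t ≤ f x}) - Real.log (ZR r l {x ∈ A | s ≤ f x}) =
      ∫ w in {x ∈ A | t ≤ f x ∧ f x < s}, dens r l {x ∈ A | f w ≤ f x} w := by
  set N : ℝ → ℝ := fun s => ∫ x in A, {x | f x < s}.indicator (fun _ => (1 : ℝ)) x with hN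
  set D : ℝ → ℝ := fun s => Real.log (ZR r l {x ∈ A | s ≤ f x}) +
    ∫ w in {x ∈ A | f x < s}, dens r l {x ∈ A | f w ≤ f x} w with hD
  have hlt : ∀ u, MeasurableSet {x | f x < u} := fun u => measurableSet_lt hf measurable_const
  have hNv : ∀ u, N u = volume.real {x ∈ A | f x < u} := by
    intro u
    simp only [hN]
    rw [integral_indicator (hlt u), Measure.restrict_restrict (hlt u), setIntegral_const,
      smul_eq_mul, mul_one, Set.inter_comm]
    rfl
  have hsplit : ∀ {t s : ℝ}, t ≤ s →
      {x ∈ A | f x < s} = {x ∈ A | f x < t} ∪ {x ∈ A | t ≤ f x ∧ f x < s} := by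
    intro t s hts
    ext x
    simp only [Set.mem_ofPred_eq, Set.mem_union]
    rcases lt_or_ge (f x) t with h | h
    · simp [h, h.trans_le hts, not_le.2 h]
    · simp [h, not_lt.2 h]
  have hdis : ∀ {t s : ℝ}, Disjoint {x ∈ A | f x < t} {x ∈ A | t ≤ f x ∧ f x < s} := by
    intro t s
    exact Set.disjoint_left.2 fun x h1 h2 => absurd h1.2 (not_lt.2 h2.2.1)
  have hmS : ∀ t s, MeasurableSet {x ∈ A | t ≤ f x ∧ f x < s} := fun t s =>
    hA.inter ((measurableSet_le measurable_const hf).inter (hlt s))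
  have hvS : ∀ {p : Euc d → Prop}, volume {x ∈ A | p x} ≠ ∞ :=
    volume_ne_top_of_subset hA' fun x hx => hx.1
  have hintegrable : ∀ {t s : ℝ}, t ≤ s →
      ∫ w in {x ∈ A | f x < s}, dens r l {x ∈ A | f w ≤ f x} w =
      (∫ w in {x ∈ A | f x < t}, dens r l {x ∈ A | f w ≤ f x} w) +
      ∫ w in {x ∈ A | t ≤ f x ∧ f x < s}, dens r l {x ∈ A | f w ≤ f x} w := by
    intro t s hts
    rw [hsplit hts]
    exact setIntegral_union hdis (hmS t s) (integrableOn_dens_level hA hA' hf hvS)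
      (integrableOn_dens_level hA hA' hf hvS)
  have hvol : ∀ {t s : ℝ}, t ≤ s →
      volume.real {x ∈ A | t ≤ f x ∧ f x < s} = N s - N t := by
    intro t s hts
    rw [hNv, hNv, hsplit hts, measureReal_union hdis (hmS t s) hvS hvS]
    ring
  have hle : ∀ s t, t ≤ s → |D s - D t| ≤ (2 * (l : ℝ) ^ 2 * ZR r l A ^ 2) * (N s - N t) ^ 2 := by
    intro s t hts
    have h := abs_log_sub_integral_le (r := r) (l := l) hA hA' hf hts
    rw [hvol hts] at h
    refine le_trans (le_of_eq ?_) h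
    rw [abs_sub_comm]
    simp only [hD]
    rw [hintegrable hts]
    congr 1
    ring
  have hall : ∀ s t, |D s - D t| ≤ (2 * (l : ℝ) ^ 2 * ZR r l A ^ 2) * (N s - N t) ^ 2 := by
    intro s t
    rcases le_total t s with h | h
    · exact hle s t h
    · rw [abs_sub_comm, ← neg_sub (N t), neg_sq]
      exact hle t s h
  have hDD := eq_of_abs_sub_le_sq (continuous_volume_sublevel hA' hf hnull) hall t s
  simp only [hD] at hDD
  rw [hintegrable hts] at hDD
  linarith

end

/-- The closed `ε`-neighbourhood in `ℂ` of the interval `[0, log (1 + x)]`. -/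
def tube (x ε : ℝ) : Set ℂ := {z | ∃ y ∈ Set.Icc (0 : ℝ) (Real.log (1 + x)), ‖z - y‖ ≤ ε}

/-- The hard sphere recursion for `log (1 + density)`. -/
def recMap {α : Type} [MeasurableSpace α] (μ : Measure α) (lam : ℂ) (z : α → ℂ) : ℂ :=
  Complex.log (1 + lam * Complex.exp (-∫ a, (Complex.exp (z a) - 1) ∂μ))

/-- Smallness conditions on the radius `ε` of the tube, the radius `η` of the disc of activities
and the contraction gap `δ`. -/
structure Gap (x ε η δ : ℝ) : Prop where
  x_nonneg : 0 ≤ x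
  ε_pos : 0 < ε
  ε_le : ε ≤ 1
  η_pos : 0 < η
  η_le : η ≤ 1 / 2
  δ_pos : 0 < δ
  δ_le : δ ≤ 1
  two_η_le : 2 * η ≤ δ * ε
  κ_le_one : 2 * (1 + x) * ε ≤ 1
  approx_le : 3 * η + 2 * x * (2 * (1 + x) * ε) ≤ δ
  κ_le : 2 * (1 + x) * ε ≤ δ
  gap : δ * (4 + 3 * x) ≤ 1 - x * Real.exp (-1)

lemma exists_gap {x : ℝ} (hx : 0 ≤ x) (hxe : x < Real.exp 1) : ∃ ε η δ, Gap x ε η δ := by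
  have hc : 0 < 1 - x * Real.exp (-1) := by
    have : x * Real.exp (-1) < Real.exp 1 * Real.exp (-1) :=
      mul_lt_mul_of_pos_right hxe (Real.exp_pos _)
    rw [← Real.exp_add] at this
    simp at this
    linarith
  have hc1 : 1 - x * Real.exp (-1) ≤ 1 := by
    have := mul_nonneg hx (Real.exp_pos (-1)).le
    linarith
  set c := 1 - x * Real.exp (-1)
  set τ := c / (4 + 3 * x) with hτ
  have hτ0 : 0 < τ := by positivity
  have hτc : τ * (4 + 3 * x) = c := by rw [hτ]; field_simp
  have hτ1 : τ ≤ 1 / 4 := by nlinarith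
  set ε := τ / (8 * (1 + x) ^ 2) with hε
  have hε0 : 0 < ε := by positivity
  have hκ : 2 * (1 + x) * ε = τ / (4 * (1 + x)) := by rw [hε]; field_simp; ring
  have hκτ : 2 * (1 + x) * ε ≤ τ / 4 := by
    rw [hκ, div_le_div_iff₀ (by positivity) (by positivity)]
    nlinarith
  have hκ2 : 2 * x * (2 * (1 + x) * ε) ≤ τ / 2 := by
    rw [hκ, ← mul_div_assoc, div_le_div_iff₀ (by positivity) (by positivity)]
    nlinarith
  have hε1 : ε ≤ 1 := by nlinarith
  refine ⟨ε, τ * ε / 6, τ, hx, hε0, hε1, by positivity, ?_, hτ0, by linarith, ?_, ?_, ?_, ?_, ?_⟩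
  · nlinarith
  · nlinarith [mul_pos hτ0 hε0]
  · linarith
  · nlinarith
  · linarith
  · exact hτc.le

lemma Gap.numeric {x ε η δ : ℝ} (h : Gap x ε η δ) {lam Y : ℂ} {y K : ℝ}
    (hlam : ‖lam - x‖ ≤ η) (hy0 : 0 ≤ y) (hyx : y ≤ x) (hY : ‖Y - y‖ ≤ 2 * (1 + x) * ε)
    (hK0 : 0 ≤ K) (hK : K ≤ y + 1 + 2 * (1 + x) * ε) :
    0 < (1 + lam * Complex.exp (-Y)).re ∧
      ‖lam * Complex.exp (-Y)‖ * K ≤ (1 - δ) * ‖1 + lam * Complex.exp (-Y)‖ := by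
  obtain ⟨hx, hε0, hε1, hη0, hη1, hδ0, hδ1, hηδ, hκ1, happ, hκδ, hgap⟩ := h
  set κ := 2 * (1 + x) * ε with hκ
  have hκ0 : 0 ≤ κ := by positivity
  set a := x * Real.exp (-y) with ha
  have ha0 : 0 ≤ a := by positivity
  have hexp1 : Real.exp (-y) ≤ 1 := Real.exp_le_one_iff.2 (by linarith)
  have hax : a ≤ x := mul_le_of_le_one_right hx hexp1
  have hay : a * y ≤ x * Real.exp (-1) := by
    have := mul_le_mul_of_nonneg_left (Real.mul_exp_neg_le_exp_neg_one y) hx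
    rw [ha]
    linarith
  have hey : ‖Complex.exp (-(y : ℂ))‖ = Real.exp (-y) := by
    rw [Complex.norm_exp]; simp
  have hdiff : ‖Complex.exp (-Y) - Complex.exp (-(y : ℂ))‖ ≤ 2 * κ := by
    have e : Complex.exp (-Y) - Complex.exp (-(y : ℂ)) =
        Complex.exp (-(y : ℂ)) * (Complex.exp (-(Y - y)) - 1) := by
      rw [mul_sub, ← Complex.exp_add, mul_one]
      congr 2
      ring
    rw [e, norm_mul, hey]
    have h1 : ‖Complex.exp (-(Y - y)) - 1‖ ≤ 2 * ‖-(Y - (y : ℂ))‖ :=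
      Complex.norm_exp_sub_one_le (by rw [norm_neg]; linarith)
    rw [norm_neg] at h1
    calc Real.exp (-y) * ‖Complex.exp (-(Y - y)) - 1‖ ≤ 1 * (2 * κ) :=
          mul_le_mul hexp1 (by linarith) (norm_nonneg _) zero_le_one
      _ = 2 * κ := one_mul _
  have heY : ‖Complex.exp (-Y)‖ ≤ 3 := by
    have := norm_le_norm_add_norm_sub' (Complex.exp (-Y)) (Complex.exp (-(y : ℂ)))
    rw [hey] at this
    linarith
  have hdist : ‖lam * Complex.exp (-Y) - (a : ℂ)‖ ≤ δ := by
    have e : lam * Complex.exp (-Y) - (a : ℂ) = (lam - x) * Complex.exp (-Y) +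
        x * (Complex.exp (-Y) - Complex.exp (-(y : ℂ))) := by
      rw [ha]
      push_cast
      ring
    rw [e]
    refine (norm_add_le _ _).trans ?_
    rw [norm_mul, norm_mul, Complex.norm_real, Real.norm_of_nonneg hx]
    have h1 : ‖lam - x‖ * ‖Complex.exp (-Y)‖ ≤ η * 3 :=
      mul_le_mul hlam heY (norm_nonneg _) hη0.le
    have h2 := mul_le_mul_of_nonneg_left hdiff hx
    linarith
  have hδ4 : δ ≤ 1 / 4 := by
    have := mul_nonneg hx (Real.exp_pos (-1)).le
    nlinarith
  have hre : 1 + a - δ ≤ (1 + lam * Complex.exp (-Y)).re := by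
    have h1 := (Complex.abs_re_le_norm _).trans hdist
    have h2 := (abs_le.1 h1).1
    simp only [Complex.sub_re, Complex.ofReal_re] at h2
    rw [Complex.add_re, Complex.one_re]
    linarith
  refine ⟨by linarith, ?_⟩
  have hden : 1 + a - δ ≤ ‖1 + lam * Complex.exp (-Y)‖ := hre.trans (Complex.re_le_norm _)
  have hnum : ‖lam * Complex.exp (-Y)‖ ≤ a + δ := by
    have := norm_le_norm_add_norm_sub' (lam * Complex.exp (-Y)) (a : ℂ)
    rw [Complex.norm_real, Real.norm_of_nonneg ha0] at this
    linarith
  calc ‖lam * Complex.exp (-Y)‖ * K ≤ (a + δ) * (y + 1 + κ) :=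
        mul_le_mul hnum hK hK0 (by linarith)
    _ ≤ (1 - δ) * (1 + a - δ) := by
        have h1 : a * κ ≤ x * δ := mul_le_mul hax hκδ hκ0 hx
        have h2 : δ * (y + 1 + κ) ≤ δ * (x + 2) := mul_le_mul_of_nonneg_left (by linarith) hδ0.le
        have h3 : δ * a ≤ δ * x := mul_le_mul_of_nonneg_left hax hδ0.le
        nlinarith [mul_nonneg hx hδ0.le]
    _ ≤ _ := mul_le_mul_of_nonneg_left hden (by linarith)

lemma convex_tube (x ε : ℝ) : Convex ℝ (tube x ε) := by
  rintro z ⟨y, hy, hz⟩ z' ⟨y', hy', hz'⟩ a b ha hb hab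
  refine ⟨a * y + b * y', convex_Icc _ _ hy hy' ha hb hab, ?_⟩
  have e : a • z + b • z' - ((a * y + b * y' : ℝ) : ℂ) = a • (z - y) + b • (z' - y') := by
    simp only [Complex.real_smul]
    push_cast
    ring
  rw [e]
  refine (norm_add_le _ _).trans ?_
  rw [norm_smul, norm_smul, Real.norm_of_nonneg ha, Real.norm_of_nonneg hb]
  calc a * ‖z - y‖ + b * ‖z' - y'‖ ≤ a * ε + b * ε := by gcongr
    _ = ε := by rw [← add_mul, hab, one_mul]

/-- The point of `[0, log (1 + x)]` nearest to `z`. -/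
def clampRe (x : ℝ) (z : ℂ) : ℝ := max 0 (min (Real.log (1 + x)) z.re)

lemma clampRe_mem {x : ℝ} (hx : 0 ≤ x) (z : ℂ) :
    clampRe x z ∈ Set.Icc (0 : ℝ) (Real.log (1 + x)) :=
  ⟨le_max_left _ _, max_le (Real.log_nonneg (by linarith)) (min_le_left _ _)⟩

lemma measurable_clampRe (x : ℝ) : Measurable (clampRe x) :=
  measurable_const.max (measurable_const.min Complex.measurable_re)

lemma norm_sub_clampRe_le {x ε : ℝ} {z : ℂ} (hz : z ∈ tube x ε) :
    ‖z - clampRe x z‖ ≤ ε := by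
  obtain ⟨y, ⟨hy0, hy1⟩, hy⟩ := hz
  refine le_trans ?_ hy
  have h : |z.re - clampRe x z| ≤ |z.re - y| := by
    unfold clampRe
    rcases le_total z.re 0 with h1 | h1
    · rw [min_eq_right (by linarith), max_eq_left h1, abs_of_nonpos (by linarith),
        abs_of_nonpos (by linarith)]
      linarith
    · rcases le_total (Real.log (1 + x)) z.re with h2 | h2
      · rw [min_eq_left h2, max_eq_right (by linarith), abs_of_nonneg (by linarith),
          abs_of_nonneg (by linarith)]
        linarith
      · rw [min_eq_right h2, max_eq_right h1]
        simp
  refine (sq_le_sq₀ (norm_nonneg _) (norm_nonneg _)).1 ?_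
  rw [Complex.sq_norm, Complex.sq_norm, Complex.normSq_apply, Complex.normSq_apply]
  simp only [Complex.sub_re, Complex.sub_im, Complex.ofReal_re, Complex.ofReal_im]
  have := sq_le_sq.2 h
  nlinarith

lemma ofReal_mem_tube {x ε y : ℝ} (hε : 0 ≤ ε) (hy : y ∈ Set.Icc (0 : ℝ) (Real.log (1 + x))) :
    (y : ℂ) ∈ tube x ε := ⟨y, hy, by simpa using hε⟩

lemma norm_le_of_mem_tube {x ε : ℝ} {z : ℂ} (hz : z ∈ tube x ε) :
    ‖z‖ ≤ Real.log (1 + x) + ε := by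
  obtain ⟨y, ⟨hy0, hy1⟩, hy⟩ := hz
  have := norm_le_norm_add_norm_sub' z (y : ℂ)
  rw [Complex.norm_real, Real.norm_of_nonneg hy0] at this
  linarith

section
variable {α : Type} [MeasurableSpace α] {μ : Measure α} [IsFiniteMeasure μ]

lemma integrable_exp_of_bound {z : α → ℂ} (hz : Measurable z) {B : ℝ} (hB : ∀ a, ‖z a‖ ≤ B) :
    Integrable (fun a => Complex.exp (z a)) μ := by
  refine Integrable.of_bound (Complex.measurable_exp.comp hz).aestronglyMeasurable (Real.exp B)
    (Eventually.of_forall fun a => ?_)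
  rw [Complex.norm_exp]
  exact Real.exp_le_exp.2 ((Complex.re_le_norm _).trans (hB a))

/-- The integral against a submeasure of a real profile with values in `[0, log (1 + x)]`. -/
lemma integral_exp_sub_one_mem {x : ℝ} (hx : 0 ≤ x) (hμ : μ Set.univ ≤ 1) {c : α → ℝ}
    (hc : ∀ a, c a ∈ Set.Icc (0 : ℝ) (Real.log (1 + x))) :
    0 ≤ ∫ a, (Real.exp (c a) - 1) ∂μ ∧ ∫ a, (Real.exp (c a) - 1) ∂μ ≤ x := by
  have hm : μ.real Set.univ ≤ 1 := ENNReal.toReal_mono ENNReal.one_ne_top hμ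
  have h1 : ∀ a, Real.exp (c a) ≤ 1 + x := fun a => by
    rw [← Real.exp_log (by linarith : 0 < 1 + x)]
    exact Real.exp_le_exp.2 (hc a).2
  refine ⟨integral_nonneg fun a => sub_nonneg.2 (Real.one_le_exp (hc a).1), ?_⟩
  calc ∫ a, (Real.exp (c a) - 1) ∂μ ≤ ∫ _, x ∂μ := by
        refine integral_mono_of_nonneg (Eventually.of_forall fun a =>
          sub_nonneg.2 (Real.one_le_exp (hc a).1)) (integrable_const _)
          (Eventually.of_forall fun a => ?_)
        have := h1 a
        simp only
        linarith
    _ = μ.real Set.univ * x := by rw [integral_const, smul_eq_mul]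
    _ ≤ x := mul_le_of_le_one_left hx hm

lemma Gap.bound {x ε η δ : ℝ} (h : Gap x ε η δ) (hμ : μ Set.univ ≤ 1) {lam : ℂ}
    (hlam : ‖lam - x‖ ≤ η) {z : α → ℂ} (hzm : Measurable z) (hz : ∀ a, z a ∈ tube x ε) :
    0 < (1 + lam * Complex.exp (-∫ a, (Complex.exp (z a) - 1) ∂μ)).re ∧
      ‖lam * Complex.exp (-∫ a, (Complex.exp (z a) - 1) ∂μ)‖ * ∫ a, ‖Complex.exp (z a)‖ ∂μ ≤
        (1 - δ) * ‖1 + lam * Complex.exp (-∫ a, (Complex.exp (z a) - 1) ∂μ)‖ := by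
  have hx := h.x_nonneg
  have hm : μ.real Set.univ ≤ 1 := ENNReal.toReal_mono ENNReal.one_ne_top hμ
  set c : α → ℝ := fun a => clampRe x (z a) with hc
  have hcm : Measurable c := (measurable_clampRe x).comp hzm
  have hcI : ∀ a, c a ∈ Set.Icc (0 : ℝ) (Real.log (1 + x)) := fun a => clampRe_mem hx _
  have hzb : ∀ a, ‖z a‖ ≤ Real.log (1 + x) + ε := fun a => norm_le_of_mem_tube (hz a)
  have hi := integrable_exp_of_bound (μ := μ) hzm hzb
  have hic := integrable_exp_of_bound (μ := μ) (z := fun a => (c a : ℂ))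
    (Complex.measurable_ofReal.comp hcm) (B := Real.log (1 + x)) fun a => by
      rw [Complex.norm_real, Real.norm_of_nonneg (hcI a).1]; exact (hcI a).2
  have hicr : Integrable (fun a => Real.exp (c a)) μ := by
    have := hic.re
    simpa [← Complex.ofReal_exp] using this
  obtain ⟨hy0, hyx⟩ := integral_exp_sub_one_mem (μ := μ) hx hμ hcI
  set κ := 2 * (1 + x) * ε with hκ
  have hκ0 : 0 ≤ κ := by have := h.ε_pos; positivity
  have hpt : ∀ a, ‖Complex.exp (z a) - Complex.exp (c a)‖ ≤ κ := by
    intro a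
    have h1 := norm_sub_clampRe_le (hz a)
    have e : Complex.exp (z a) - Complex.exp (c a) =
        Complex.exp (c a) * (Complex.exp (z a - c a) - 1) := by
      rw [mul_sub, ← Complex.exp_add, mul_one]
      congr 2
      ring
    have h2 : ‖Complex.exp (z a - c a) - 1‖ ≤ 2 * ‖z a - c a‖ :=
      Complex.norm_exp_sub_one_le (h1.trans h.ε_le)
    have h3 : Real.exp (c a) ≤ 1 + x := by
      rw [← Real.exp_log (by linarith : 0 < 1 + x)]
      exact Real.exp_le_exp.2 (hcI a).2
    rw [e, norm_mul, Complex.norm_exp_ofReal]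
    calc Real.exp (c a) * ‖Complex.exp (z a - c a) - 1‖ ≤ (1 + x) * (2 * ε) :=
          mul_le_mul h3 (h2.trans (by linarith)) (norm_nonneg _) (by linarith)
      _ = κ := by rw [hκ]; ring
  refine h.numeric hlam hy0 hyx ?_ (integral_nonneg fun a => norm_nonneg _) ?_
  · have e : (∫ a, (Complex.exp (z a) - 1) ∂μ) - ((∫ a, (Real.exp (c a) - 1) ∂μ : ℝ) : ℂ) =
        ∫ a, (Complex.exp (z a) - Complex.exp (c a)) ∂μ := by
      have h1 : Integrable (fun a => Complex.exp (z a) - 1) μ := hi.sub (integrable_const _)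
      have h2 : Integrable (fun a => ((Real.exp (c a) - 1 : ℝ) : ℂ)) μ :=
        (hicr.sub (integrable_const 1)).ofReal
      rw [← integral_complex_ofReal, ← integral_sub h1 h2]
      refine integral_congr_ae (Eventually.of_forall fun a => ?_)
      simp
    rw [e]
    refine (norm_integral_le_of_norm_le_const (Eventually.of_forall hpt)).trans ?_
    exact mul_le_of_le_one_right hκ0 hm
  · have hle : ∫ a, ‖Complex.exp (z a)‖ ∂μ ≤ ∫ a, ((Real.exp (c a) - 1) + (1 + κ)) ∂μ := by
      refine integral_mono hi.norm ((hicr.sub (integrable_const _)).add (integrable_const _))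
        fun a => ?_
      have h1 := norm_le_norm_add_norm_sub' (Complex.exp (z a)) (Complex.exp (c a))
      rw [Complex.norm_exp_ofReal] at h1
      have := hpt a
      simp only
      linarith
    have h3 : Integrable (fun a => Real.exp (c a) - 1) μ := hicr.sub (integrable_const _)
    rw [integral_add h3 (integrable_const _), integral_const,
      smul_eq_mul] at hle
    have := mul_le_of_le_one_left (by linarith : 0 ≤ 1 + κ) hm
    linarith

lemma hasDerivAt_integral_exp_segment {z w : α → ℂ} (hz : Measurable z) (hw : Measurable w)
    {B : ℝ} (hzB : ∀ a, ‖z a‖ ≤ B) (hwB : ∀ a, ‖w a‖ ≤ B) (t : ℝ) :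
    HasDerivAt (fun t : ℝ => ∫ a, (Complex.exp (z a + t * (w a - z a)) - 1) ∂μ)
      (∫ a, Complex.exp (z a + t * (w a - z a)) * (w a - z a) ∂μ) t := by
  have hB : ∀ a, ‖w a - z a‖ ≤ 2 * B := fun a =>
    (norm_sub_le _ _).trans (by linarith [hzB a, hwB a])
  have hm : ∀ s : ℝ, Measurable fun a => z a + s * (w a - z a) := fun s =>
    hz.add ((hw.sub hz).const_mul _)
  have hb : ∀ (s : ℝ) a, ‖z a + s * (w a - z a)‖ ≤ B + |s| * (2 * B) := fun s a => by
    refine (norm_add_le _ _).trans (add_le_add (hzB a) ?_)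
    rw [norm_mul, Complex.norm_real, Real.norm_eq_abs]
    exact mul_le_mul_of_nonneg_left (hB a) (abs_nonneg _)
  refine (hasDerivAt_integral_of_dominated_loc_of_deriv_le (s := Metric.ball t 1)
    (F := fun (t : ℝ) a => Complex.exp (z a + t * (w a - z a)) - 1)
    (F' := fun (t : ℝ) a => Complex.exp (z a + t * (w a - z a)) * (w a - z a))
    (bound := fun _ => Real.exp (B + (|t| + 1) * (2 * B)) * (2 * B))
    (Metric.ball_mem_nhds t one_pos) (Eventually.of_forall fun s => ?_) ?_ ?_
    (Eventually.of_forall fun a s hs => ?_) (integrable_const _)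
    (Eventually.of_forall fun a s _ => ?_)).2
  · exact ((Complex.measurable_exp.comp (hm s)).sub_const _).aestronglyMeasurable
  · exact (integrable_exp_of_bound (hm t) (hb t)).sub (integrable_const _)
  · exact ((Complex.measurable_exp.comp (hm t)).mul (hw.sub hz)).aestronglyMeasurable
  · have hB0 : 0 ≤ B := (norm_nonneg _).trans (hzB a)
    have hs' : |s| ≤ |t| + 1 := by
      have h1 : |s - t| < 1 := by simpa [Real.dist_eq] using hs
      have h2 : |s| ≤ |t| + |s - t| := by
        simpa using abs_add_le t (s - t)
      linarith
    rw [norm_mul, Complex.norm_exp]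
    refine mul_le_mul (Real.exp_le_exp.2 ?_) (hB a) (norm_nonneg _) (Real.exp_pos _).le
    refine (Complex.re_le_norm _).trans ((hb s a).trans ?_)
    gcongr
  · have h1 : HasDerivAt (fun t : ℂ => Complex.exp (z a + t * (w a - z a)) - 1)
        (Complex.exp (z a + s * (w a - z a)) * (1 * (w a - z a))) (s : ℂ) :=
      ((((hasDerivAt_id (s : ℂ)).mul_const (w a - z a)).const_add (z a)).cexp).sub_const 1
    simpa using h1.comp_ofReal

theorem Gap.contraction {x ε η δ : ℝ} (h : Gap x ε η δ) (hμ : μ Set.univ ≤ 1) {lam : ℂ}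
    (hlam : ‖lam - x‖ ≤ η) {z w : α → ℂ} (hzm : Measurable z) (hwm : Measurable w)
    (hz : ∀ a, z a ∈ tube x ε) (hw : ∀ a, w a ∈ tube x ε) {s : ℝ}
    (hs : ∀ᵐ a ∂μ, ‖w a - z a‖ ≤ s) (hs0 : 0 ≤ s) :
    ‖recMap μ lam w - recMap μ lam z‖ ≤ (1 - δ) * s := by
  have hseg : ∀ t ∈ Set.Icc (0 : ℝ) 1, ∀ a, z a + t * (w a - z a) ∈ tube x ε := by
    intro t ht a
    have := (convex_tube x ε).add_smul_sub_mem (hz a) (hw a) ht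
    simpa using this
  have hmeas : ∀ t : ℝ, Measurable fun a => z a + t * (w a - z a) := fun t =>
    hzm.add ((hwm.sub hzm).const_mul _)
  set f : ℝ → ℂ := fun t => recMap μ lam fun a => z a + t * (w a - z a) with hf
  set Y : ℝ → ℂ := fun t => ∫ a, (Complex.exp (z a + t * (w a - z a)) - 1) ∂μ with hY
  set Y' : ℝ → ℂ := fun t => ∫ a, Complex.exp (z a + t * (w a - z a)) * (w a - z a) ∂μ with hY'
  have hYd : ∀ t, HasDerivAt Y (Y' t) t := hasDerivAt_integral_exp_segment hzm hwm
    (fun a => norm_le_of_mem_tube (hz a)) fun a => norm_le_of_mem_tube (hw a)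
  have hfd : ∀ t ∈ Set.Icc (0 : ℝ) 1, HasDerivAt f
      (lam * (Complex.exp (-Y t) * -Y' t) / (1 + lam * Complex.exp (-Y t))) t := by
    intro t ht
    have hb := (h.bound hμ hlam (hmeas t) (hseg t ht)).1
    have h1 : HasDerivAt (fun t => Complex.exp (-Y t)) (Complex.exp (-Y t) * -Y' t) t := by
      have := (Complex.hasDerivAt_exp (-Y t)).comp_of_eq t (hYd t).neg rfl
      exact this
    exact HasDerivAt.clog_real ((h1.const_mul lam).const_add 1) (Or.inl hb)
  have hbd : ∀ t ∈ Set.Icc (0 : ℝ) 1,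
      ‖lam * (Complex.exp (-Y t) * -Y' t) / (1 + lam * Complex.exp (-Y t))‖ ≤ (1 - δ) * s := by
    intro t ht
    obtain ⟨hre, hb⟩ := h.bound hμ hlam (hmeas t) (hseg t ht)
    have hne : 0 < ‖1 + lam * Complex.exp (-Y t)‖ := norm_pos_iff.2 fun h0 => by
      simp only [hY] at h0
      rw [h0] at hre
      simp at hre
    have hintegrable := integrable_exp_of_bound (μ := μ) (hmeas t)
      fun a => norm_le_of_mem_tube (hseg t ht a)
    have hY'b : ‖Y' t‖ ≤ (∫ a, ‖Complex.exp (z a + t * (w a - z a))‖ ∂μ) * s := by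
      rw [← integral_mul_const]
      refine norm_integral_le_of_norm_le (hintegrable.norm.mul_const s) ?_
      filter_upwards [hs] with a ha
      rw [norm_mul]
      exact mul_le_mul_of_nonneg_left ha (norm_nonneg _)
    rw [norm_div, div_le_iff₀ hne, ← mul_assoc, norm_mul, norm_neg]
    calc ‖lam * Complex.exp (-Y t)‖ * ‖Y' t‖ ≤ ‖lam * Complex.exp (-Y t)‖ *
          ((∫ a, ‖Complex.exp (z a + t * (w a - z a))‖ ∂μ) * s) :=
          mul_le_mul_of_nonneg_left hY'b (norm_nonneg _)
      _ = (‖lam * Complex.exp (-Y t)‖ *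
          ∫ a, ‖Complex.exp (z a + t * (w a - z a))‖ ∂μ) * s := by ring
      _ ≤ ((1 - δ) * ‖1 + lam * Complex.exp (-Y t)‖) * s := mul_le_mul_of_nonneg_right hb hs0
      _ = _ := by ring
  have key := norm_image_sub_le_of_norm_deriv_le_segment_01' (f := f)
    (fun t ht => (hfd t ht).hasDerivWithinAt) (fun t ht => hbd t ⟨ht.1, ht.2.le⟩)
  have e1 : f 1 = recMap μ lam w := by simp [hf]
  have e0 : f 0 = recMap μ lam z := by simp [hf]
  rwa [e1, e0] at key

lemma norm_log_sub_log_le {u v : ℂ} (hu : 1 / 2 ≤ u.re) (hv : 1 / 2 ≤ v.re) :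
    ‖Complex.log u - Complex.log v‖ ≤ 2 * ‖u - v‖ := by
  refine (convex_halfSpace_re_ge (1 / 2)).norm_image_sub_le_of_norm_hasDerivWithin_le
    (f := Complex.log) (f' := fun u => u⁻¹) (fun w hw => ?_) (fun w hw => ?_) hv hu
  · have hw' : (1 : ℝ) / 2 ≤ w.re := hw
    exact (Complex.hasDerivAt_log (Or.inl (by linarith))).hasDerivWithinAt
  · have hw' : (1 : ℝ) / 2 ≤ w.re := hw
    have h1 : (1 : ℝ) / 2 ≤ ‖w‖ := hw'.trans (Complex.re_le_norm w)
    rw [norm_inv]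
    exact inv_le_of_inv_le₀ (by norm_num) (by linarith)

theorem Gap.invariant {x ε η δ : ℝ} (h : Gap x ε η δ) (hμ : μ Set.univ ≤ 1) {lam : ℂ}
    (hlam : ‖lam - x‖ ≤ η) {z : α → ℂ} (hzm : Measurable z) (hz : ∀ a, z a ∈ tube x ε) :
    recMap μ lam z ∈ tube x ε := by
  have hx := h.x_nonneg
  set c : α → ℝ := fun a => clampRe x (z a) with hc
  have hcm : Measurable c := (measurable_clampRe x).comp hzm
  have hcI : ∀ a, c a ∈ Set.Icc (0 : ℝ) (Real.log (1 + x)) := fun a => clampRe_mem hx _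
  obtain ⟨hy0, hyx⟩ := integral_exp_sub_one_mem (μ := μ) hx hμ hcI
  set y := ∫ a, (Real.exp (c a) - 1) ∂μ with hy
  have h1 : ‖recMap μ lam z - recMap μ lam fun a => (c a : ℂ)‖ ≤ (1 - δ) * ε :=
    h.contraction hμ hlam (Complex.measurable_ofReal.comp hcm) hzm
      (fun a => ofReal_mem_tube h.ε_pos.le (hcI a)) hz
      (Eventually.of_forall fun a => norm_sub_clampRe_le (hz a)) h.ε_pos.le
  have e : ∫ a, (Complex.exp (c a : ℂ) - 1) ∂μ = (y : ℂ) := by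
    rw [hy, ← integral_complex_ofReal]
    refine integral_congr_ae (Eventually.of_forall fun a => ?_)
    simp
  have hE1 : Real.exp (-y) ≤ 1 := Real.exp_le_one_iff.2 (by linarith)
  have hE0 := Real.exp_pos (-y)
  have hexp : Complex.exp (-(y : ℂ)) = (Real.exp (-y) : ℝ) := by push_cast; rfl
  have h2 : ‖recMap μ lam (fun a => (c a : ℂ)) - (Real.log (1 + x * Real.exp (-y)) : ℝ)‖ ≤
      2 * η := by
    have hxE : 0 ≤ x * Real.exp (-y) := by positivity
    rw [recMap, e, Complex.ofReal_log (by linarith), hexp]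
    have hd : ‖(1 + lam * (Real.exp (-y) : ℝ)) - ((1 + x * Real.exp (-y) : ℝ) : ℂ)‖ ≤ η := by
      have e2 : (1 + lam * (Real.exp (-y) : ℝ)) - ((1 + x * Real.exp (-y) : ℝ) : ℂ) =
          (lam - x) * (Real.exp (-y) : ℝ) := by
        push_cast
        ring
      rw [e2, norm_mul, Complex.norm_real, Real.norm_of_nonneg hE0.le]
      exact (mul_le_of_le_one_right (norm_nonneg _) hE1).trans hlam
    refine (norm_log_sub_log_le ?_ ?_).trans (by linarith)
    · have h3 := (abs_le.1 ((Complex.abs_re_le_norm _).trans hd)).1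
      rw [Complex.sub_re, Complex.ofReal_re] at h3
      linarith [h.η_le]
    · rw [Complex.ofReal_re]
      linarith
  refine ⟨Real.log (1 + x * Real.exp (-y)), ⟨Real.log_nonneg ?_, Real.log_le_log ?_ ?_⟩, ?_⟩
  · nlinarith
  · nlinarith
  · nlinarith
  · have h3 := norm_sub_le_norm_sub_add_norm_sub (recMap μ lam z)
      (recMap μ lam fun a => (c a : ℂ)) (Real.log (1 + x * Real.exp (-y)) : ℝ)
    have := h.two_η_le
    linarith

end

/-- Bounded holomorphic dependence on a parameter passes through integrals over finite
measures. -/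
lemma differentiableOn_integral_of_bound {α : Type} [MeasurableSpace α] {μ : Measure α}
    [IsFiniteMeasure μ] {U : Set ℂ} (hU : IsOpen U) {F : ℂ → α → ℂ} {B : ℝ}
    (hm : ∀ lam ∈ U, Measurable (F lam)) (hd : ∀ a, DifferentiableOn ℂ (fun lam => F lam a) U)
    (hB : ∀ lam ∈ U, ∀ a, ‖F lam a‖ ≤ B) :
    DifferentiableOn ℂ (fun lam => ∫ a, F lam a ∂μ) U := by
  intro c hc
  obtain ⟨ρ, hρ, hball⟩ := Metric.isOpen_iff.1 hU c hc
  have hsub : ∀ z ∈ Metric.ball c (ρ / 2), Metric.ball z (ρ / 2) ⊆ U := fun z hz =>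
    (Metric.ball_subset_ball' (by have := Metric.mem_ball.1 hz; linarith)).trans hball
  have hderiv : ∀ a, ∀ z ∈ U, HasDerivAt (fun lam => F lam a) (deriv (fun lam => F lam a) z) z :=
    fun a z hz => ((hd a).differentiableAt (hU.mem_nhds hz)).hasDerivAt
  have hmeas : Measurable fun a => deriv (fun lam => F lam a) c := by
    have hseq : Tendsto (fun n : ℕ => ((ρ / 2 / (n + 1) : ℝ) : ℂ)) atTop (𝓝[≠] 0) := by
      refine tendsto_nhdsWithin_iff.2 ⟨?_, Eventually.of_forall fun n => ?_⟩
      · rw [← Complex.ofReal_zero]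
        refine (Complex.continuous_ofReal.tendsto 0).comp ?_
        have := (tendsto_one_div_add_atTop_nhds_zero_nat (𝕜 := ℝ)).const_mul (ρ / 2)
        simpa [div_eq_mul_inv] using this
      · have : (0 : ℝ) < ρ / 2 / (n + 1) := by positivity
        exact Complex.ofReal_ne_zero.2 this.ne'
    refine measurable_of_tendsto_metrizable (f := fun (n : ℕ) a =>
      ((ρ / 2 / (n + 1) : ℝ) : ℂ)⁻¹ * (F (c + ((ρ / 2 / (n + 1) : ℝ) : ℂ)) a - F c a))
      (fun n => ?_) (tendsto_pi_nhds.2 fun a => ?_)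
    · refine ((hm _ (hball ?_)).sub (hm c hc)).const_mul _
      have h0 : (0 : ℝ) < ρ / 2 / (n + 1) := by positivity
      rw [mem_ball_iff_norm, add_sub_cancel_left, Complex.norm_real, Real.norm_of_nonneg h0.le]
      have : ρ / 2 / (n + 1) ≤ ρ / 2 :=
        div_le_self (by linarith) (by linarith [n.cast_nonneg (α := ℝ)])
      linarith
    · have := (hasDerivAt_iff_tendsto_slope_zero.1 (hderiv a c hc)).comp hseq
      simpa [Function.comp_def] using this
  refine (hasDerivAt_integral_of_dominated_loc_of_deriv_le (s := Metric.ball c (ρ / 2))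
    (F := F) (F' := fun lam a => deriv (fun lam => F lam a) lam)
    (bound := fun _ => B / (ρ / 4)) (Metric.ball_mem_nhds c (by linarith)) ?_ ?_ ?_
    (Eventually.of_forall fun a z hz => ?_) (integrable_const _)
    (Eventually.of_forall fun a z hz => ?_)).2.differentiableAt.differentiableWithinAt
  · filter_upwards [hU.mem_nhds hc] with z hz using (hm z hz).aestronglyMeasurable
  · exact Integrable.of_bound (hm c hc).aestronglyMeasurable B (Eventually.of_forall (hB c hc))
  · exact hmeas.aestronglyMeasurable
  · have hcl : Metric.closedBall z (ρ / 4) ⊆ U :=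
      (Metric.closedBall_subset_ball (by linarith)).trans (hsub z hz)
    refine Complex.norm_deriv_le_of_forall_mem_sphere_norm_le (by linarith) ?_ fun y hy =>
      hB y (hcl (Metric.sphere_subset_closedBall hy)) a
    refine ((hd a).mono ?_).diffContOnCl
    rw [closure_ball _ (by linarith)]
    exact hcl
  · exact hderiv a z (hsub z hz (Metric.mem_ball_self (by linarith)))

/-- The part of `A` which is at least as far from the origin as `u`, seen from `u`. -/
def shell {d : ℕ} (A : Set (Euc d)) (u : Euc d) : Set (Euc d) := {y | ‖u‖ ≤ ‖y + u‖ ∧ y + u ∈ A}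

/-- The iterates of the hard sphere recursion for `log (1 + density at the origin)`. -/
def iter {d : ℕ} (r : ℝ) : ℕ → ℂ → Set (Euc d) → ℂ
  | 0, _, _ => 0
  | n + 1, lam, A =>
    recMap (volume.restrict (A ∩ Metric.ball 0 r)) lam fun u => iter r n lam (shell A u)

section
variable {d : ℕ} {r : ℝ}

lemma measurableSet_shell_family {T : Type} [MeasurableSpace T] {F : Set (T × Euc d)}
    (hF : MeasurableSet F) :
    MeasurableSet {p : (T × Euc d) × Euc d | p.2 ∈ shell {x | (p.1.1, x) ∈ F} p.1.2} := by
  have h1 : Measurable fun p : (T × Euc d) × Euc d => p.1.2 := measurable_snd.comp measurable_fst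
  have h2 : Measurable fun p : (T × Euc d) × Euc d => p.2 + p.1.2 := measurable_snd.add h1
  exact (measurableSet_le h1.norm h2.norm).inter
    (((measurable_fst.comp measurable_fst).prodMk h2) hF)

lemma measurableSet_shell {A : Set (Euc d)} (hA : MeasurableSet A) (u : Euc d) :
    MeasurableSet (shell A u) :=
  (measurableSet_le measurable_const (measurable_id.add_const u).norm).inter
    ((measurable_id.add_const u) hA)

lemma measurable_iter_family (n : ℕ) (lam : ℂ) {T : Type} [MeasurableSpace T]
    {F : Set (T × Euc d)} (hF : MeasurableSet F) :
    Measurable fun t => iter r n lam {x | (t, x) ∈ F} := by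
  induction n generalizing T with
  | zero => exact measurable_const
  | succ n ih =>
    have h1 := ih (measurableSet_shell_family hF)
    have hS : MeasurableSet {p : T × Euc d | p ∈ F ∧ p.2 ∈ Metric.ball (0 : Euc d) r} :=
      hF.inter (measurable_snd measurableSet_ball)
    have h2 : Measurable ({p : T × Euc d | p ∈ F ∧ p.2 ∈ Metric.ball (0 : Euc d) r}.indicator
        fun p => Complex.exp (iter r n lam (shell {x | (p.1, x) ∈ F} p.2)) - 1) :=
      ((Complex.measurable_exp.comp h1).sub_const 1).indicator hS
    have h3 := (StronglyMeasurable.integral_prod_right' (ν := (volume : Measure (Euc d)))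
      h2.stronglyMeasurable).measurable
    have e : ∀ t, ∫ u in {x | (t, x) ∈ F} ∩ Metric.ball 0 r,
        (Complex.exp (iter r n lam (shell {x | (t, x) ∈ F} u)) - 1) =
        ∫ u, {p : T × Euc d | p ∈ F ∧ p.2 ∈ Metric.ball (0 : Euc d) r}.indicator
          (fun p => Complex.exp (iter r n lam (shell {x | (p.1, x) ∈ F} p.2)) - 1) (t, u) := by
      intro t
      have hSt : MeasurableSet ({x | (t, x) ∈ F} ∩ Metric.ball (0 : Euc d) r) :=
        measurable_prodMk_left hS
      rw [← integral_indicator hSt]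
      rfl
    simp only [iter, recMap, e]
    exact Complex.measurable_log.comp
      (((Complex.measurable_exp.comp h3.neg).const_mul lam).const_add 1)

lemma measurable_iter_shell (n : ℕ) (lam : ℂ) {A : Set (Euc d)} (hA : MeasurableSet A) :
    Measurable fun u => iter r n lam (shell A u) := by
  have hF : MeasurableSet {p : Euc d × Euc d | p.2 ∈ shell A p.1} :=
    (measurableSet_le measurable_fst.norm (measurable_snd.add measurable_fst).norm).inter
      ((measurable_snd.add measurable_fst) hA)
  exact measurable_iter_family n lam hF

lemma restrict_univ_le_one (hvol : volume (Metric.ball (0 : Euc d) r) = 1) (A : Set (Euc d)) :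
    (volume.restrict (A ∩ Metric.ball (0 : Euc d) r)) Set.univ ≤ 1 := by
  rw [Measure.restrict_apply_univ, ← hvol]
  exact measure_mono Set.inter_subset_right

lemma isFiniteMeasure_restrict (hvol : volume (Metric.ball (0 : Euc d) r) = 1)
    (A : Set (Euc d)) : IsFiniteMeasure (volume.restrict (A ∩ Metric.ball (0 : Euc d) r)) :=
  ⟨(restrict_univ_le_one hvol A).trans_lt ENNReal.one_lt_top⟩

variable {x ε η δ : ℝ} {lam : ℂ} {A : Set (Euc d)}

lemma Gap.iter_mem_tube (h : Gap x ε η δ) (hvol : volume (Metric.ball (0 : Euc d) r) = 1)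
    (hlam : ‖lam - x‖ ≤ η) (n : ℕ) (hA : MeasurableSet A) : iter r n lam A ∈ tube x ε := by
  induction n generalizing A with
  | zero =>
    have := h.x_nonneg
    exact ofReal_mem_tube (y := 0) h.ε_pos.le ⟨le_rfl, Real.log_nonneg (by linarith)⟩
  | succ n ih =>
    have := isFiniteMeasure_restrict hvol A
    exact h.invariant (restrict_univ_le_one hvol A) hlam (measurable_iter_shell n lam hA)
      fun u => ih (measurableSet_shell hA u)

lemma Gap.norm_iter_succ_sub (h : Gap x ε η δ)
    (hvol : volume (Metric.ball (0 : Euc d) r) = 1) (hlam : ‖lam - x‖ ≤ η) (n : ℕ)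
    (hA : MeasurableSet A) :
    ‖iter r (n + 1) lam A - iter r n lam A‖ ≤ (1 - δ) ^ n * (Real.log (1 + x) + ε) := by
  induction n generalizing A with
  | zero =>
    have := norm_le_of_mem_tube (h.iter_mem_tube hvol hlam 1 hA)
    simpa [iter] using this
  | succ n ih =>
    have := isFiniteMeasure_restrict hvol A
    have h1 := h.δ_le
    have hL := Real.log_nonneg (by linarith [h.x_nonneg] : 1 ≤ 1 + x)
    have hε := h.ε_pos
    rw [pow_succ', mul_assoc]
    exact h.contraction (restrict_univ_le_one hvol A) hlam (measurable_iter_shell n lam hA)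
      (measurable_iter_shell (n + 1) lam hA)
      (fun u => h.iter_mem_tube hvol hlam n (measurableSet_shell hA u))
      (fun u => h.iter_mem_tube hvol hlam (n + 1) (measurableSet_shell hA u))
      (Eventually.of_forall fun u => ih (measurableSet_shell hA u))
      (mul_nonneg (pow_nonneg (by linarith) _) (by linarith))

lemma Gap.differentiableOn_iter (h : Gap x ε η δ)
    (hvol : volume (Metric.ball (0 : Euc d) r) = 1) (n : ℕ) (hA : MeasurableSet A) :
    DifferentiableOn ℂ (fun lam => iter r n lam A) (Metric.ball (x : ℂ) η) := by
  have hle : ∀ z ∈ Metric.ball (x : ℂ) η, ‖z - x‖ ≤ η := fun z hz => (mem_ball_iff_norm.1 hz).le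
  induction n generalizing A with
  | zero => exact differentiableOn_const _
  | succ n ih =>
    have := isFiniteMeasure_restrict hvol A
    have hY : DifferentiableOn ℂ (fun lam => ∫ u in A ∩ Metric.ball 0 r,
        (Complex.exp (iter r n lam (shell A u)) - 1)) (Metric.ball (x : ℂ) η) := by
      refine differentiableOn_integral_of_bound Metric.isOpen_ball
        (B := Real.exp (Real.log (1 + x) + ε) + 1) (fun z _ => ?_) (fun u => ?_)
        fun z hz u => ?_
      · exact (Complex.measurable_exp.comp (measurable_iter_shell n z hA)).sub_const 1
      · exact ((ih (measurableSet_shell hA u)).cexp).sub_const 1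
      · refine (norm_sub_le _ _).trans ?_
        rw [norm_one, Complex.norm_exp]
        have h1 := norm_le_of_mem_tube
          (h.iter_mem_tube hvol (hle z hz) n (measurableSet_shell hA u))
        have h2 := Real.exp_le_exp.2 ((Complex.re_le_norm _).trans h1)
        linarith
    refine DifferentiableOn.clog ((differentiableOn_id.mul hY.neg.cexp).const_add 1) fun z hz => ?_
    exact Or.inl (h.bound (restrict_univ_le_one hvol A) (hle z hz) (measurable_iter_shell n z hA)
      fun u => h.iter_mem_tube hvol (hle z hz) n (measurableSet_shell hA u)).1

/-- The limit of the iterates of the hard sphere recursion. -/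
def iterLim (r : ℝ) (A : Set (Euc d)) (lam : ℂ) : ℂ := limUnder atTop fun n => iter r n lam A

lemma Gap.tendsto_iter (h : Gap x ε η δ) (hvol : volume (Metric.ball (0 : Euc d) r) = 1)
    (hlam : ‖lam - x‖ ≤ η) (hA : MeasurableSet A) :
    Tendsto (fun n => iter r n lam A) atTop (𝓝 (iterLim r A lam)) := by
  refine CauchySeq.tendsto_limUnder (cauchySeq_of_le_geometric (1 - δ) (Real.log (1 + x) + ε)
    (by linarith [h.δ_pos]) fun n => ?_)
  rw [dist_comm, dist_eq_norm, mul_comm]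
  exact h.norm_iter_succ_sub hvol hlam n hA

lemma Gap.norm_iter_sub_iterLim (h : Gap x ε η δ)
    (hvol : volume (Metric.ball (0 : Euc d) r) = 1) (hlam : ‖lam - x‖ ≤ η)
    (hA : MeasurableSet A) (n : ℕ) :
    ‖iter r n lam A - iterLim r A lam‖ ≤ (Real.log (1 + x) + ε) * (1 - δ) ^ n / δ := by
  have := dist_le_of_le_geometric_of_tendsto (1 - δ) (Real.log (1 + x) + ε)
    (by linarith [h.δ_pos]) (fun n => ?_) (h.tendsto_iter hvol hlam hA) n
  · rw [dist_eq_norm] at this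
    simpa using this
  · rw [dist_comm, dist_eq_norm, mul_comm]
    exact h.norm_iter_succ_sub hvol hlam n hA

lemma Gap.norm_iterLim_le (h : Gap x ε η δ) (hvol : volume (Metric.ball (0 : Euc d) r) = 1)
    (hlam : ‖lam - x‖ ≤ η) (hA : MeasurableSet A) :
    ‖iterLim r A lam‖ ≤ Real.log (1 + x) + ε :=
  le_of_tendsto (h.tendsto_iter hvol hlam hA).norm
    (Eventually.of_forall fun n => norm_le_of_mem_tube (h.iter_mem_tube hvol hlam n hA))

lemma Gap.differentiableOn_iterLim (h : Gap x ε η δ)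
    (hvol : volume (Metric.ball (0 : Euc d) r) = 1) (hA : MeasurableSet A) :
    DifferentiableOn ℂ (iterLim r A) (Metric.ball (x : ℂ) η) := by
  have hδ0 := h.δ_pos
  have hδ1 := h.δ_le
  have hunif : TendstoUniformlyOn (fun n lam => iter r n lam A) (iterLim r A) atTop
      (Metric.ball (x : ℂ) η) := by
    rw [Metric.tendstoUniformlyOn_iff]
    intro c hc
    have hlim : Tendsto (fun n : ℕ => (Real.log (1 + x) + ε) * (1 - δ) ^ n / δ) atTop (𝓝 0) := by
      have := ((tendsto_pow_atTop_nhds_zero_of_lt_one (by linarith : 0 ≤ 1 - δ)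
        (by linarith)).const_mul (Real.log (1 + x) + ε)).div_const δ
      simpa using this
    filter_upwards [hlim.eventually (gt_mem_nhds hc)] with n hn z hz
    rw [dist_comm, dist_eq_norm]
    exact (h.norm_iter_sub_iterLim hvol (mem_ball_iff_norm.1 hz).le hA n).trans_lt hn
  exact hunif.tendstoLocallyUniformlyOn.differentiableOn
    (Eventually.of_forall fun n => h.differentiableOn_iter hvol n hA) Metric.isOpen_ball

end

section
variable {d : ℕ} {r : ℝ} {l : NNReal} {A : Set (Euc d)}

lemma volume_coord_eq (i : Fin d) (c : ℝ) : volume {x : Euc d | x i = c} = 0 := by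
  have h := (PiLp.volume_preserving_ofLp (Fin d)).measure_preimage
    (s := {f : Fin d → ℝ | f i = c})
    (measurableSet_eq_fun (measurable_pi_apply i) measurable_const).nullMeasurableSet
  exact h.trans (Measure.pi_hyperplane (fun _ : Fin d => (volume : Measure ℝ)) i c)

lemma measurable_coord (i : Fin d) : Measurable fun x : Euc d => x i :=
  (EuclideanSpace.proj i : Euc d →L[ℝ] ℝ).measurable

/-- The exact recursion for the density of the finite volume hard sphere model. -/
lemma dens_eq_exp (hd : 1 ≤ d) (hr : 0 < r) (hA : MeasurableSet A) (hA' : volume A ≠ ∞)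
    (v : Euc d) :
    dens r l A v = l * Real.exp (-∫ u in {u | v + u ∈ A} ∩ Metric.ball 0 r,
      dens r l {y ∈ A | ‖u‖ ≤ dist y v} (v + u)) := by
  have : Nonempty (Fin d) := ⟨⟨0, hd⟩⟩
  have h := log_ZR_sub (r := r) (l := l) (f := fun x => dist x v) hA hA'
    (measurable_id.dist measurable_const) (fun c => Measure.addHaar_sphere volume v c) hr.le
  have e0 : {x ∈ A | (0 : ℝ) ≤ dist x v} = A := by
    ext x
    simp
  have e1 : (fun u => v + u) ⁻¹' {x ∈ A | (0 : ℝ) ≤ dist x v ∧ dist x v < r} =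
      {u | v + u ∈ A} ∩ Metric.ball 0 r := by
    ext u
    simp
  rw [← (measurePreserving_add_left volume v).setIntegral_preimage_emb
    (measurableEmbedding_addLeft v), e0, e1] at h
  simp only [dist_self_add_left] at h
  have hp : ∀ {B : Set (Euc d)}, volume B ≠ ∞ → 0 < ZR r l B := fun hB =>
    zero_lt_one.trans_le (one_le_ZR hB)
  rw [← h, neg_sub, Real.exp_sub, Real.exp_log (hp hA'),
    Real.exp_log (hp (volume_ne_top_of_subset hA' fun x hx => hx.1)), dens]

lemma measurable_dens_shell (hA : MeasurableSet A) (v : Euc d) :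
    Measurable fun u => dens r l {y ∈ A | ‖u‖ ≤ dist y v} (v + u) := by
  have hF : MeasurableSet {p : Euc d × Euc d | p.2 ∈ A ∧ ‖p.1‖ ≤ dist p.2 v} :=
    (measurable_snd hA).inter
      (measurableSet_le measurable_fst.norm (measurable_snd.dist measurable_const))
  exact measurable_dens_family hF (measurable_const.add measurable_id)

/-- The logarithm of one plus the density, as a complex number. -/
def logDens {d : ℕ} (r : ℝ) (l : NNReal) (A : Set (Euc d)) (v : Euc d) : ℂ :=
  (Real.log (1 + dens r l A v) : ℝ)

lemma exp_logDens (A : Set (Euc d)) (v : Euc d) :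
    Complex.exp (logDens r l A v) = 1 + (dens r l A v : ℝ) := by
  have := dens_nonneg (r := r) (l := l) A v
  rw [logDens, ← Complex.ofReal_exp, Real.exp_log (by linarith)]
  push_cast
  rfl

lemma log_dens_mem_Icc (hA : volume A ≠ ∞) (v : Euc d) :
    Real.log (1 + dens r l A v) ∈ Set.Icc (0 : ℝ) (Real.log (1 + (l : ℝ))) := by
  have h0 := dens_nonneg (r := r) (l := l) A v
  exact ⟨Real.log_nonneg (by linarith),
    Real.log_le_log (by linarith) (by linarith [dens_le (r := r) (l := l) hA v])⟩

lemma logDens_eq_recMap (hd : 1 ≤ d) (hr : 0 < r) (hA : MeasurableSet A) (hA' : volume A ≠ ∞)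
    (v : Euc d) :
    logDens r l A v = recMap (volume.restrict ({u | v + u ∈ A} ∩ Metric.ball 0 r)) (l : ℝ)
      fun u => logDens r l {y ∈ A | ‖u‖ ≤ dist y v} (v + u) := by
  have h0 := dens_nonneg (r := r) (l := l) A v
  simp only [recMap, exp_logDens, add_sub_cancel_left]
  rw [logDens, Complex.ofReal_log (by linarith), dens_eq_exp hd hr hA hA', integral_complex_ofReal]
  push_cast
  rfl

variable {ε η δ : ℝ}

/-- Up to distance `n r`, only the shape of the domain near a point matters for the `n`-th
iterate. -/
lemma Gap.norm_logDens_sub_iter (h : Gap l ε η δ) (hd : 1 ≤ d) (hr : 0 < r)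
    (hvol : volume (Metric.ball (0 : Euc d) r) = 1) (n : ℕ) {A' : Set (Euc d)}
    (hA : MeasurableSet A) (hAf : volume A ≠ ∞) (hA' : MeasurableSet A') (v : Euc d)
    (hloc : ∀ u : Euc d, ‖u‖ < n * r → (v + u ∈ A ↔ u ∈ A')) :
    ‖logDens r l A v - iter r n (l : ℝ) A'‖ ≤ (1 - δ) ^ n * Real.log (1 + l) := by
  induction n generalizing A A' v with
  | zero =>
    have h1 := log_dens_mem_Icc (r := r) (l := l) hAf v
    simp only [iter, sub_zero, pow_zero, one_mul, logDens, Complex.norm_real]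
    rw [Real.norm_of_nonneg h1.1]
    exact h1.2
  | succ n ih =>
    have := isFiniteMeasure_restrict hvol A'
    have hL := Real.log_nonneg (by linarith [h.x_nonneg] : 1 ≤ 1 + (l : ℝ))
    have hset : {u | v + u ∈ A} ∩ Metric.ball 0 r = A' ∩ Metric.ball 0 r := by
      ext u
      refine and_congr_left fun hu => hloc u ?_
      have h1 : ‖u‖ < r := by simpa using hu
      have h2 : 0 ≤ n * r := by positivity
      push_cast
      linarith
    have hsub : ∀ u : Euc d, volume {y ∈ A | ‖u‖ ≤ dist y v} ≠ ∞ := fun u =>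
      volume_ne_top_of_subset hAf fun y hy => hy.1
    rw [logDens_eq_recMap hd hr hA hAf, hset, iter, pow_succ', mul_assoc]
    refine h.contraction (restrict_univ_le_one hvol A') (by simpa using h.η_pos.le)
      (measurable_iter_shell n _ hA')
      (Complex.measurable_ofReal.comp
        (Real.measurable_log.comp ((measurable_dens_shell hA v).const_add 1)))
      (fun u => h.iter_mem_tube hvol (by simpa using h.η_pos.le) n (measurableSet_shell hA' u))
      (fun u => ofReal_mem_tube h.ε_pos.le (log_dens_mem_Icc (hsub u) _)) ?_
      (mul_nonneg (pow_nonneg (by linarith [h.δ_le]) _) hL)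
    have hball : ∀ᵐ u ∂volume.restrict (A' ∩ Metric.ball (0 : Euc d) r),
        u ∈ Metric.ball (0 : Euc d) r :=
      ae_restrict_of_ae_restrict_of_subset Set.inter_subset_right
        (ae_restrict_mem measurableSet_ball)
    filter_upwards [hball] with u hu
    have hur : ‖u‖ < r := by simpa using hu
    refine ih (hA.inter (measurableSet_le measurable_const (measurable_id.dist measurable_const)))
      (hsub u) (measurableSet_shell hA' u) (v + u) fun y hy => ?_
    have hyu : ‖y + u‖ < (n + 1 : ℕ) * r := by
      have := norm_add_le y u
      push_cast
      linarith
    have e : v + u + y = v + (y + u) := by abel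
    rw [e]
    have := hloc (y + u) hyu
    simp only [shell, Set.mem_inter_iff, Set.mem_ofPred_eq, id, dist_self_add_left, this]
    exact and_comm

lemma norm_exp_sub_exp_le {z w : ℂ} {C : ℝ} (hz : ‖z‖ ≤ C) (hw : ‖w‖ ≤ C) :
    ‖Complex.exp z - Complex.exp w‖ ≤ Real.exp C * ‖z - w‖ := by
  refine (convex_closedBall (0 : ℂ) C).norm_image_sub_le_of_norm_hasDerivWithin_le
    (f := Complex.exp) (f' := Complex.exp)
    (fun u _ => (Complex.hasDerivAt_exp u).hasDerivWithinAt) (fun u hu => ?_)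
    (mem_closedBall_zero_iff.2 hw) (mem_closedBall_zero_iff.2 hz)
  rw [Complex.norm_exp]
  exact Real.exp_le_exp.2 ((Complex.re_le_norm u).trans (mem_closedBall_zero_iff.1 hu))

/-- Near a point where `A` looks like `A'` up to distance `n r`, the density is close to its
infinite volume value. -/
lemma Gap.norm_dens_sub_le (h : Gap l ε η δ) (hd : 1 ≤ d) (hr : 0 < r)
    (hvol : volume (Metric.ball (0 : Euc d) r) = 1) (n : ℕ) {A' : Set (Euc d)}
    (hA : MeasurableSet A) (hAf : volume A ≠ ∞) (hA' : MeasurableSet A') (v : Euc d)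
    (hloc : ∀ u : Euc d, ‖u‖ < n * r → (v + u ∈ A ↔ u ∈ A')) :
    ‖(dens r l A v : ℂ) - (Complex.exp (iterLim r A' (l : ℝ)) - 1)‖ ≤
      Real.exp (Real.log (1 + l) + ε) *
        (Real.log (1 + l) + (Real.log (1 + l) + ε) / δ) * (1 - δ) ^ n := by
  have hη : ‖((l : ℝ) : ℂ) - (l : ℝ)‖ ≤ η := by simpa using h.η_pos.le
  have e : (dens r l A v : ℂ) - (Complex.exp (iterLim r A' (l : ℝ)) - 1) =
      Complex.exp (logDens r l A v) - Complex.exp (iterLim r A' (l : ℝ)) := by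
    rw [exp_logDens]
    ring
  have h1 : ‖logDens r l A v‖ ≤ Real.log (1 + l) + ε :=
    norm_le_of_mem_tube (ofReal_mem_tube h.ε_pos.le (log_dens_mem_Icc hAf v))
  rw [e, mul_assoc]
  refine (norm_exp_sub_exp_le h1 (h.norm_iterLim_le hvol hη hA')).trans
    (mul_le_mul_of_nonneg_left ?_ (Real.exp_pos _).le)
  refine (norm_sub_le_norm_sub_add_norm_sub _ (iter r n (l : ℝ) A') _).trans
    ((add_le_add (h.norm_logDens_sub_iter hd hr hvol n hA hAf hA' v hloc)
      (h.norm_iter_sub_iterLim hvol hη hA' n)).trans (le_of_eq ?_))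
  ring

end

section
variable {d : ℕ} {r : ℝ} {l : NNReal}

/-- The axis-parallel cube of half side `a` centered at the origin. -/
def box (d : ℕ) (a : ℝ) : Set (Euc d) := {x | ∀ i, |x i| ≤ a}

lemma measurableSet_box (a : ℝ) : MeasurableSet (box d a) := by
  have : box d a = ⋂ i, {x : Euc d | |x i| ≤ a} := by
    ext
    simp [box]
  rw [this]
  exact MeasurableSet.iInter fun i =>
    measurableSet_le (measurable_coord i).norm measurable_const

lemma volume_box (a : ℝ) : volume (box d a) = ENNReal.ofReal (2 * a) ^ d := by
  have h := (PiLp.volume_preserving_ofLp (Fin d)).measure_preimage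
    (s := Set.univ.pi fun _ : Fin d => Set.Icc (-a) a)
    (MeasurableSet.univ_pi fun _ => measurableSet_Icc).nullMeasurableSet
  have e : (WithLp.ofLp ⁻¹' Set.univ.pi fun _ : Fin d => Set.Icc (-a) a) = box d a := by
    ext
    simp [box, abs_le, Pi.le_def, forall_and]
  rw [e, volume_pi_pi] at h
  rw [h]
  simp [two_mul]

lemma volume_real_box {a : ℝ} (ha : 0 ≤ a) : volume.real (box d a) = (2 * a) ^ d := by
  rw [Measure.real, volume_box, ENNReal.toReal_pow, ENNReal.toReal_ofReal (by linarith)]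

lemma volume_box_ne_top (a : ℝ) : volume (box d a) ≠ ∞ := by
  rw [volume_box]
  exact ENNReal.pow_ne_top ENNReal.ofReal_ne_top

lemma integral_hsWeight (k : ℕ) {A : Set (Euc d)} (hA : MeasurableSet A) :
    ∫ x in Set.univ.pi (fun _ : Fin k => A), hsWeight d r k x = volume.real (conf r k A) := by
  rw [← integral_indicator (MeasurableSet.univ_pi fun _ => hA),
    ← integral_indicator_one (measurableSet_conf r k hA)]
  congr 1
  ext x
  have hw : hsWeight d r k x = if ∀ i j, i ≠ j → r ≤ dist (x i) (x j) then 1 else 0 := by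
    rw [hsWeight, Finset.prod_ite_zero, Finset.prod_const_one]
    congr 1
    refine propext ⟨fun h i j hij => ?_, fun h p hp => h _ _ ?_⟩
    · rcases lt_or_gt_of_ne hij with h1 | h1
      · exact h (i, j) (by simpa using h1)
      · rw [dist_comm]
        exact h (j, i) (by simpa using h1)
    · have : p.1 < p.2 := by simpa using hp
      exact this.ne
  by_cases h1 : ∀ j, x j ∈ A <;> by_cases h2 : ∀ i j, i ≠ j → r ≤ dist (x i) (x j) <;>
    simp [Set.indicator, conf, hw, h1, h2]

lemma Zhs_eq_ZR {A : Set (Euc d)} (hA : MeasurableSet A) (hA' : volume A ≠ ∞) :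
    Zhs d r A l = ZR r l A := by
  have hfin : ∀ k, (l : ℝ≥0∞) ^ k / (Nat.factorial k : ℝ≥0∞) * volume (conf r k A) ≠ ∞ :=
    ENNReal.ne_top_of_tsum_ne_top (ZE_lt_top r l hA')
  rw [Zhs, ZR, ZE, ENNReal.tsum_toReal_eq hfin]
  refine tsum_congr fun k => ?_
  rw [integral_hsWeight k hA, ENNReal.toReal_mul, ENNReal.toReal_div, ENNReal.toReal_pow]
  rfl

lemma log_ZR_box (hd : 1 ≤ d) (a : ℝ) :
    Real.log (ZR r l (box d a)) = ∫ w in box d a,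
      dens r l {x ∈ box d a | w ⟨0, hd⟩ ≤ x ⟨0, hd⟩} w := by
  have h := log_ZR_sub (r := r) (l := l) (f := fun x : Euc d => x ⟨0, hd⟩)
    (measurableSet_box a) (volume_box_ne_top a) (measurable_coord _) (volume_coord_eq _)
    (t := -|a|) (s := |a| + 1) (by linarith [abs_nonneg a])
  have hb : ∀ x ∈ box d a, -|a| ≤ x ⟨0, hd⟩ ∧ x ⟨0, hd⟩ < |a| + 1 := fun x hx => by
    have h1 := abs_le.1 (hx ⟨0, hd⟩)
    have h2 := le_abs_self a
    exact ⟨by linarith, by linarith⟩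
  have e0 : {x ∈ box d a | -|a| ≤ x ⟨0, hd⟩} = box d a :=
    Set.ext fun x => ⟨fun hx => hx.1, fun hx => ⟨hx, (hb x hx).1⟩⟩
  have e1 : {x ∈ box d a | |a| + 1 ≤ x ⟨0, hd⟩} = ∅ :=
    Set.eq_empty_of_forall_notMem fun x hx => (hb x hx.1).2.not_ge hx.2
  have e2 : {x ∈ box d a | -|a| ≤ x ⟨0, hd⟩ ∧ x ⟨0, hd⟩ < |a| + 1} = box d a :=
    Set.ext fun x => ⟨fun hx => hx.1, fun hx => ⟨hx, hb x hx⟩⟩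
  rw [e0, e1, e2, ZR_empty, Real.log_one, sub_zero] at h
  exact h

/-- The infinite volume pressure: the limiting density at a boundary point of a half space. -/
def pressure (d : ℕ) (hd : 1 ≤ d) (r : ℝ) (lam : ℂ) : ℂ :=
  Complex.exp (iterLim r {x : Euc d | 0 ≤ x ⟨0, hd⟩} lam) - 1

lemma measurableSet_halfSpace (i : Fin d) : MeasurableSet {x : Euc d | 0 ≤ x i} :=
  measurableSet_le measurable_const (measurable_coord i)

variable {ε η δ : ℝ}

lemma Gap.norm_pressure_box_sub_le (h : Gap l ε η δ) (hd : 1 ≤ d) (hr : 0 < r)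
    (hvol : volume (Metric.ball (0 : Euc d) r) = 1) (n : ℕ) {a : ℝ} (ha : 0 < a)
    (hna : n * r ≤ a) :
    ‖((((2 * a) ^ d)⁻¹ * Real.log (ZR r l (box d a)) : ℝ) : ℂ) - pressure d hd r (l : ℝ)‖ ≤
      Real.exp (Real.log (1 + l) + ε) *
        (Real.log (1 + l) + (Real.log (1 + l) + ε) / δ) * (1 - δ) ^ n +
      (l + ‖pressure d hd r (l : ℝ)‖) * (1 - (1 - n * r / a) ^ d) := by
  set P := pressure d hd r (l : ℝ) with hP
  set c := Real.exp (Real.log (1 + l) + ε) *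
    (Real.log (1 + l) + (Real.log (1 + l) + ε) / δ) * (1 - δ) ^ n with hc
  set D := l + ‖P‖ with hD
  have hD0 : 0 ≤ D := by positivity
  have hδ0 := h.δ_pos
  have hδ1 := h.δ_le
  have hε0 := h.ε_pos
  have hL := Real.log_nonneg (by linarith [h.x_nonneg] : 1 ≤ 1 + (l : ℝ))
  have hc0 : 0 ≤ c := by
    have : 0 ≤ 1 - δ := by linarith
    positivity
  set g : Euc d → ℝ := fun w => dens r l {x ∈ box d a | w ⟨0, hd⟩ ≤ x ⟨0, hd⟩} w with hg
  have hsub : ∀ w : Euc d, volume {x ∈ box d a | w ⟨0, hd⟩ ≤ x ⟨0, hd⟩} ≠ ∞ := fun w =>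
    volume_ne_top_of_subset (volume_box_ne_top a) fun x hx => hx.1
  have hbf : IsFiniteMeasure (volume.restrict (box d a)) :=
    ⟨by rw [Measure.restrict_apply_univ]; exact (volume_box_ne_top a).lt_top⟩
  have hgi : IntegrableOn (fun w => (g w : ℂ)) (box d a) :=
    (integrableOn_dens_level (measurableSet_box a) (volume_box_ne_top a)
      (measurable_coord ⟨0, hd⟩) (volume_box_ne_top a)).ofReal
  set b := a - n * r with hb
  have hb0 : 0 ≤ b := by linarith
  have hba : box d b ⊆ box d a := fun x hx i =>
    (hx i).trans (sub_le_self a (by positivity))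
  have hpt : ∀ w ∈ box d a, ‖(g w : ℂ) - P‖ ≤
      c + (box d b)ᶜ.indicator (fun _ => D) w := by
    intro w hw
    by_cases hwb : w ∈ box d b
    · rw [Set.indicator_of_notMem (by simpa using hwb), add_zero]
      refine h.norm_dens_sub_le hd hr hvol n ((measurableSet_box a).inter
        (measurableSet_le measurable_const (measurable_coord _))) (hsub w)
        (measurableSet_halfSpace ⟨0, hd⟩) w fun u hu => ?_
      have hin : w + u ∈ box d a := fun i => by
        have h1 := hwb i
        have h2 : ‖u i‖ ≤ ‖u‖ := PiLp.norm_apply_le u i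
        have h3 := abs_add_le (w i) (u i)
        rw [Real.norm_eq_abs] at h2
        rw [PiLp.add_apply]
        linarith
      simp [hin]
    · rw [Set.indicator_of_mem (by simpa using hwb)]
      have h1 := norm_sub_le (g w : ℂ) P
      have h2 := dens_nonneg (r := r) (l := l) {x ∈ box d a | w ⟨0, hd⟩ ≤ x ⟨0, hd⟩} w
      have h3 := dens_le (r := r) (l := l) (hsub w) w
      rw [Complex.norm_real, Real.norm_of_nonneg h2] at h1
      linarith
  have hvb : volume.real (box d a) = (2 * a) ^ d := volume_real_box ha.le
  have hpow : (0 : ℝ) < (2 * a) ^ d := by positivity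
  have e1 : ((((2 * a) ^ d)⁻¹ * Real.log (ZR r l (box d a)) : ℝ) : ℂ) - P =
      (((2 * a) ^ d)⁻¹ : ℝ) * ∫ w in box d a, ((g w : ℂ) - P) := by
    rw [integral_sub hgi (integrable_const _), integral_complex_ofReal, ← log_ZR_box hd a,
      setIntegral_const, hvb, mul_sub, Complex.real_smul, ← mul_assoc, ← Complex.ofReal_mul,
      ← Complex.ofReal_mul, inv_mul_cancel₀ hpow.ne', Complex.ofReal_one, one_mul]
  have hind : Integrable ((box d b)ᶜ.indicator fun _ => D) (volume.restrict (box d a)) :=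
    (integrable_const D).indicator (measurableSet_box b).compl
  have e2 : ∫ w in box d a, (c + (box d b)ᶜ.indicator (fun _ => D) w) =
      (2 * a) ^ d * c + ((2 * a) ^ d - (2 * b) ^ d) * D := by
    rw [integral_add (integrable_const c) hind, setIntegral_const, hvb,
      integral_indicator (measurableSet_box b).compl,
      Measure.restrict_restrict (measurableSet_box b).compl, setIntegral_const,
      Set.inter_comm, ← Set.sdiff_eq, measureReal_sdiff hba (measurableSet_box b)
        (volume_box_ne_top a), hvb, volume_real_box hb0]
    rfl
  have hle : ‖∫ w in box d a, ((g w : ℂ) - P)‖ ≤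
      (2 * a) ^ d * c + ((2 * a) ^ d - (2 * b) ^ d) * D := by
    rw [← e2]
    refine norm_integral_le_of_norm_le ((integrable_const c).add hind) ?_
    filter_upwards [ae_restrict_mem (measurableSet_box a)] with w hw using hpt w hw
  rw [e1, norm_mul, Complex.norm_real, Real.norm_of_nonneg (by positivity)]
  refine (mul_le_mul_of_nonneg_left hle (by positivity)).trans (le_of_eq ?_)
  have e3 : 1 - n * r / a = 2 * b / (2 * a) := by
    rw [hb]
    field_simp
  rw [e3, div_pow]
  field_simp

lemma cube_eq_box (V : ℝ) : cube d V = box d (V ^ (1 / (d : ℝ)) / 2) := rfl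

lemma Gap.tendsto_pressure (h : Gap l ε η δ) (hd : 1 ≤ d) (hr : 0 < r)
    (hvol : volume (Metric.ball (0 : Euc d) r) = 1) :
    Tendsto (fun V : ℝ => ((V⁻¹ * Real.log (Zhs d r (cube d V) l) : ℝ) : ℂ))
      atTop (𝓝 (pressure d hd r (l : ℝ))) := by
  have hd0 : (0 : ℝ) < d := by exact_mod_cast hd
  have hδ0 := h.δ_pos
  have hδ1 := h.δ_le
  set P := pressure d hd r (l : ℝ) with hP
  set K := Real.exp (Real.log (1 + l) + ε) *
    (Real.log (1 + l) + (Real.log (1 + l) + ε) / δ) with hK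
  have hside : Tendsto (fun V : ℝ => V ^ (1 / (d : ℝ)) / 2) atTop atTop :=
    (tendsto_rpow_atTop (by positivity)).atTop_div_const two_pos
  rw [Metric.tendsto_nhds]
  intro e he
  have hgeo : Tendsto (fun n : ℕ => K * (1 - δ) ^ n) atTop (𝓝 0) := by
    simpa using (tendsto_pow_atTop_nhds_zero_of_lt_one (by linarith : 0 ≤ 1 - δ)
      (by linarith)).const_mul K
  obtain ⟨n, hn⟩ := (hgeo.eventually (gt_mem_nhds (half_pos he))).exists
  have hbdry : Tendsto (fun V : ℝ => (l + ‖P‖) *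
      (1 - (1 - n * r / (V ^ (1 / (d : ℝ)) / 2)) ^ d)) atTop (𝓝 0) := by
    have h1 := ((((hside.const_div_atTop (n * r)).const_sub 1).pow d).const_sub 1).const_mul
      (l + ‖P‖)
    simpa using h1
  filter_upwards [hbdry.eventually (gt_mem_nhds (half_pos he)), eventually_gt_atTop 0,
    hside.eventually_ge_atTop (n * r)] with V h1 hV h2
  set a := V ^ (1 / (d : ℝ)) / 2 with ha
  have ha0 : 0 < a := by positivity
  have hVa : V = (2 * a) ^ d := by
    rw [ha, mul_div_cancel₀ _ two_ne_zero, ← Real.rpow_natCast, ← Real.rpow_mul hV.le,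
      one_div_mul_cancel hd0.ne', Real.rpow_one]
  rw [cube_eq_box, Zhs_eq_ZR (measurableSet_box _) (volume_box_ne_top _), dist_eq_norm, hVa]
  have h3 := h.norm_pressure_box_sub_le hd hr hvol n ha0 h2
  rw [← hVa] at h3 ⊢
  exact h3.trans_lt (by linarith)

end

end

/-- Corollary 1.3: for the hard sphere model with `r` the radius of the ball of
volume 1, the pressure is analytic on a complex neighborhood of `[0, e)`. -/
theorem hard_sphere_pressure_analytic
    (d : ℕ) (hd : 1 ≤ d)
    (r : ℝ) (hr : 0 < r)
    (hvol : volume (Metric.ball (0 : Euc d) r) = 1) :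
    ∃ Ω : Set ℂ, IsOpen Ω ∧
      (∀ lam : ℝ, lam ∈ Set.Ico 0 (Real.exp 1) → (lam : ℂ) ∈ Ω) ∧
      ∃ p : ℂ → ℂ, AnalyticOnNhd ℂ p Ω ∧
        ∀ lam : ℝ, lam ∈ Set.Ico 0 (Real.exp 1) →
          Tendsto (fun V : ℝ => ((V⁻¹ * Real.log (Zhs d r (cube d V) lam) : ℝ) : ℂ))
            atTop (nhds (p lam)) := by
  refine ⟨{z | ∃ x ε η δ, Gap x ε η δ ∧ z ∈ Metric.ball (x : ℂ) η}, ?_, ?_,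
    pressure d hd r, ?_, ?_⟩
  · refine Metric.isOpen_iff.2 ?_
    rintro z ⟨x, ε, η, δ, h, hz⟩
    obtain ⟨ρ, hρ, hsub⟩ := Metric.isOpen_iff.1 Metric.isOpen_ball z hz
    exact ⟨ρ, hρ, fun w hw => ⟨x, ε, η, δ, h, hsub hw⟩⟩
  · intro lam hlam
    obtain ⟨ε, η, δ, h⟩ := exists_gap hlam.1 hlam.2
    exact ⟨lam, ε, η, δ, h, Metric.mem_ball_self h.η_pos⟩
  · rintro z ⟨x, ε, η, δ, h, hz⟩
    have hdiff : DifferentiableOn ℂ (pressure d hd r) (Metric.ball (x : ℂ) η) :=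
      ((h.differentiableOn_iterLim hvol (measurableSet_halfSpace ⟨0, hd⟩)).cexp).sub_const 1
    exact hdiff.analyticOnNhd Metric.isOpen_ball z hz
  · intro lam hlam
    obtain ⟨ε, η, δ, h⟩ := exists_gap hlam.1 hlam.2
    lift lam to NNReal using hlam.1
    exact h.tendsto_pressure hd hr hvol

end
end

section
/- Consider the hard sphere model in ℝ^d with r > 0 the radius of the Euclidean ball of volume 1, let Ω ⊂ ℂ be an open set containing [0, e) and p : Ω → ℂ an analytic function such that for every real λ ∈ [0, e), (1/V)·log Z_{Λ_V}(λ) → p(λ) as V → ∞ (Λ_V the axis-parallel cube of volume V centered at the origin). Define ρ_φ(λ) := λ·p′(λ) for real λ ∈ [0, e). Then: (i) for every s ∈ [0, e/(1+e)) there exists λ ∈ [0, e) with ρ_φ(λ) = s; and (ii) there exist an open set D ⊂ ℂ containing [0, e/(1+e)) and an analytic function f : D → ℂ such that f(ρ_φ(λ)) = p(λ) for every real λ ∈ [0, e) with ρ_φ(λ) ∈ D. Equivalently, the pressure of the hard sphere model in dimension d is analytic as a function of the density for packing densities 2^{−d}·ρ_φ up to (e/(1+e))·2^{−d}. (Corollary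 1.4, first statement.) -/
open MeasureTheory Filter

noncomputable section

/-- The exponential generating function of a real sequence. -/
def expGen (a : ℕ → ℝ) (x : ℝ) : ℝ := ∑' k : ℕ, x ^ k / (Nat.factorial k) * a k

theorem summable_expGen {a : ℕ → ℝ} {C R : ℝ} (ha : ∀ k, |a k| ≤ C * R ^ k) (x : ℝ) :
    Summable fun k : ℕ => x ^ k / (Nat.factorial k) * a k := by
  refine Summable.of_norm_bounded ((Real.summable_pow_div_factorial (|x| * R)).mul_left C) ?_
  intro k
  rw [norm_mul, norm_div, norm_pow, Real.norm_natCast, Real.norm_eq_abs, Real.norm_eq_abs]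
  calc |x| ^ k / (k.factorial : ℝ) * |a k| ≤ |x| ^ k / (k.factorial : ℝ) * (C * R ^ k) := by
        gcongr; exact ha k
    _ = C * ((|x| * R) ^ k / (k.factorial : ℝ)) := by rw [mul_pow]; ring

theorem hasSum_expGen {a : ℕ → ℝ} {C R : ℝ} (ha : ∀ k, |a k| ≤ C * R ^ k) (x : ℝ) :
    HasSum (fun k : ℕ => x ^ k / (Nat.factorial k) * a k) (expGen a x) :=
  (summable_expGen ha x).hasSum

theorem abs_shift_le {a : ℕ → ℝ} {C R : ℝ} (ha : ∀ k, |a k| ≤ C * R ^ k) (k : ℕ) :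
    |a (k + 1)| ≤ (C * R) * R ^ k := by
  refine (ha (k + 1)).trans_eq ?_
  ring

theorem pow_succ_div_factorial_mul (x : ℝ) (k : ℕ) :
    x ^ (k + 1) / (Nat.factorial (k + 1)) * ((k + 1 : ℕ) : ℝ) = x * (x ^ k / Nat.factorial k) := by
  have h1 : (k.factorial : ℝ) ≠ 0 := by positivity
  have h2 : (k : ℝ) + 1 ≠ 0 := by positivity
  rw [Nat.factorial_succ]
  push_cast
  field_simp
  ring

/-- Weighting the coefficients by their index corresponds to `x d/dx`. -/
theorem HasSum.expGen_index_mul {c : ℕ → ℝ} {x S : ℝ}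
    (h : HasSum (fun k : ℕ => x ^ k / (Nat.factorial k) * c (k + 1)) S) :
    HasSum (fun k : ℕ => x ^ k / (Nat.factorial k) * (k * c k)) (x * S) := by
  rw [← hasSum_nat_add_iff' 1]
  simp only [Finset.range_one, Finset.sum_singleton, CharP.cast_eq_zero, zero_mul, mul_zero,
    sub_zero]
  refine (h.mul_left x).congr_fun ?_
  intro k
  rw [← mul_assoc, pow_succ_div_factorial_mul]
  ring

theorem hasDerivAt_expGen {a : ℕ → ℝ} {C R : ℝ} (hC : 0 ≤ C) (hR : 0 ≤ R)
    (ha : ∀ k, |a k| ≤ C * R ^ k) (x : ℝ) :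
    HasDerivAt (expGen a) (expGen (fun k => a (k + 1)) x) x := by
  have key : ∀ k : ℕ, ∀ y : ℝ, (((k + 1 : ℕ) : ℝ) * y ^ k / (Nat.factorial (k + 1)))
      = y ^ k / Nat.factorial k := by
    intro k y
    have h1 : (k.factorial : ℝ) ≠ 0 := by positivity
    have h2 : (k : ℝ) + 1 ≠ 0 := by positivity
    rw [Nat.factorial_succ]
    push_cast
    field_simp
  set M : ℝ := |x| + 1 with hM
  have hM0 : 0 ≤ M := by positivity
  have hu : Summable fun k : ℕ =>
      (k : ℝ) * M ^ (k - 1) / (Nat.factorial k) * (C * R ^ k) := by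
    rw [← summable_nat_add_iff 1]
    refine (summable_expGen (a := fun k => C * R ^ (k + 1)) (C := C * R) (R := R) ?_ M).congr ?_
    · intro k
      rw [abs_of_nonneg (by positivity)]
      exact (by ring : C * R ^ (k + 1) = C * R * R ^ k).le
    · intro k
      rw [Nat.add_sub_cancel, key]
  have hd := hasDerivAt_tsum_of_isPreconnected
    (g := fun (k : ℕ) (y : ℝ) => y ^ k / (Nat.factorial k) * a k)
    (g' := fun (k : ℕ) (y : ℝ) => (k : ℝ) * y ^ (k - 1) / (Nat.factorial k) * a k)
    (t := Metric.ball 0 M) (y₀ := x) (y := x) hu Metric.isOpen_ball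
    (convex_ball 0 M).isPreconnected ?_ ?_ (by simp [hM]) (summable_expGen ha x) (by simp [hM])
  · have hs : (∑' k : ℕ, (k : ℝ) * x ^ (k - 1) / (Nat.factorial k) * a k)
        = expGen (fun k => a (k + 1)) x := by
      have := (hasSum_nat_add_iff' (f := fun k : ℕ =>
        (k : ℝ) * x ^ (k - 1) / (Nat.factorial k) * a k)
        (g := expGen (fun k => a (k + 1)) x) 1).1 ?_
      · exact this.tsum_eq
      · simp only [Finset.range_one, Finset.sum_singleton, CharP.cast_eq_zero, zero_mul, zero_div,
          sub_zero]
        refine (hasSum_expGen (abs_shift_le ha) x).congr_fun ?_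
        intro k
        rw [Nat.add_sub_cancel, key]
    rw [← hs]
    exact hd
  · intro k y _
    exact ((hasDerivAt_pow k y).div_const _).mul_const _
  · intro k y hy
    rw [mem_ball_zero_iff, Real.norm_eq_abs] at hy
    rw [norm_mul, norm_div, norm_mul, norm_pow, Real.norm_natCast, Real.norm_natCast,
      Real.norm_eq_abs, Real.norm_eq_abs]
    gcongr
    exact ha k

/-- A sequence whose successive ratios drop by at most one. -/
structure SlowRatio (a : ℕ → ℝ) (V : ℝ) : Prop where
  zero : a 0 = 1
  one : a 1 = V
  nonneg : ∀ k, 0 ≤ a k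
  le_pow : ∀ k, a k ≤ V ^ k
  sq_le : ∀ k, a (k + 1) ^ 2 ≤ a k * (a (k + 2) + a (k + 1))

namespace SlowRatio

variable {a : ℕ → ℝ} {V : ℝ}

theorem nonneg_right (h : SlowRatio a V) : 0 ≤ V := h.one ▸ h.nonneg 1

theorem abs_le (h : SlowRatio a V) (k : ℕ) : |a k| ≤ 1 * V ^ k := by
  rw [abs_of_nonneg (h.nonneg k), one_mul]
  exact h.le_pow k

theorem one_le_expGen (h : SlowRatio a V) {x : ℝ} (hx : 0 ≤ x) : 1 ≤ expGen a x := by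
  have := (summable_expGen h.abs_le x).le_tsum 0
    (fun k _ => mul_nonneg (by positivity) (h.nonneg k))
  simpa [expGen, h.zero] using this

theorem expGen_zero (h : SlowRatio a V) : expGen a 0 = 1 := by
  rw [expGen, tsum_eq_single 0]
  · simp [h.zero]
  · intro k hk
    simp [hk]

theorem hasDerivAt (h : SlowRatio a V) (x : ℝ) :
    HasDerivAt (expGen a) (expGen (fun k => a (k + 1)) x) x :=
  hasDerivAt_expGen zero_le_one h.nonneg_right h.abs_le x

theorem hasDerivAt_shift (h : SlowRatio a V) (x : ℝ) :
    HasDerivAt (expGen fun k => a (k + 1)) (expGen (fun k => a (k + 2)) x) x :=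
  hasDerivAt_expGen (mul_nonneg zero_le_one h.nonneg_right) h.nonneg_right
    (abs_shift_le h.abs_le) x

/-- The lower bound on the variance of the index, in terms of the generating function. -/
theorem expGen_mul_add_nonneg (h : SlowRatio a V) {x : ℝ} (hx : 0 ≤ x) :
    0 ≤ expGen a x * expGen (fun k => a (k + 1)) x
      + (1 + x) * (expGen a x * expGen (fun k => a (k + 2)) x
        - expGen (fun k => a (k + 1)) x ^ 2) := by
  have hA := hasSum_expGen h.abs_le x
  have hB := hasSum_expGen (abs_shift_le h.abs_le) x
  have hC := hasSum_expGen (abs_shift_le (abs_shift_le h.abs_le)) x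
  have hApos : 0 < expGen a x := zero_lt_one.trans_le (h.one_le_expGen hx)
  simp only [add_assoc, one_add_one_eq_two] at hC
  set A := expGen a x
  set B := expGen (fun k => a (k + 1)) x
  set C := expGen (fun k => a (k + 2)) x
  have hkA : HasSum (fun k : ℕ => x ^ k / (Nat.factorial k) * (k * a k)) (x * B) :=
    HasSum.expGen_index_mul hB
  have hkB : HasSum (fun k : ℕ => x ^ k / (Nat.factorial k) * (k * a (k + 1))) (x * C) :=
    HasSum.expGen_index_mul (c := fun k => a (k + 1)) hC
  have hkkA : HasSum (fun k : ℕ => x ^ k / (Nat.factorial k) * (k * (k * a k)))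
      (x * (x * C + B)) := by
    refine HasSum.expGen_index_mul (c := fun k : ℕ => k * a k) ?_
    refine (hkB.add hB).congr_fun ?_
    intro k
    push_cast
    ring
  set c := (1 + x) * B / A with hc
  have hcA : c * A = (1 + x) * B := by rw [hc]; field_simp
  have htot := (((((hC.add hB).add (hkB.mul_left 2)).add hkkA).add (hA.mul_left (c ^ 2))).sub
    (hB.mul_left (2 * c))).sub (hkA.mul_left (2 * c))
  have hnn := htot.nonneg (fun k => ?_)
  · have h1 : 0 ≤ (1 + x) * (A * B + (1 + x) * (A * C - B ^ 2)) := by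
      have := mul_nonneg hApos.le hnn
      calc 0 ≤ _ := this
        _ = (1 + x) ^ 2 * C * A + (1 + x) * B * A + (c * A) ^ 2
            - 2 * (c * A) * (1 + x) * B := by ring
        _ = _ := by rw [hcA]; ring
    exact nonneg_of_mul_nonneg_right h1 (by positivity)
  · have hbr : 0 ≤ a (k + 2) + a (k + 1) + 2 * (k * a (k + 1)) + k * (k * a k) + c ^ 2 * a k
        - 2 * c * a (k + 1) - 2 * c * (k * a k) := by
      have hs := h.sq_le k
      rcases (h.nonneg k).eq_or_lt with h0 | h0
      · rw [← h0, zero_mul] at hs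
        have h1 : a (k + 1) = 0 := by nlinarith [sq_nonneg (a (k + 1))]
        rw [← h0, h1]
        simpa using h.nonneg (k + 2)
      · refine nonneg_of_mul_nonneg_right (a := a k) ?_ h0
        nlinarith [sq_nonneg (a (k + 1) + (k - c) * a k)]
    have hp : 0 ≤ x ^ k / (Nat.factorial k : ℝ) := by positivity
    calc (0 : ℝ) ≤ _ := mul_nonneg hp hbr
      _ = _ := by ring

/-- In the variable `u = log (1 + x)`, the generating function is log-convex. -/
theorem convexOn_log_expGen (h : SlowRatio a V) :
    ConvexOn ℝ (Set.Ici 0) fun u => Real.log (expGen a (Real.exp u - 1)) := by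
  have hx : ∀ {u : ℝ}, 0 ≤ u → 0 ≤ Real.exp u - 1 := fun hu => by
    linarith [Real.one_le_exp hu]
  have hpos : ∀ {u : ℝ}, 0 ≤ u → 0 < expGen a (Real.exp u - 1) := fun hu =>
    zero_lt_one.trans_le (h.one_le_expGen (hx hu))
  have hE : ∀ u : ℝ, HasDerivAt (fun u => Real.exp u - 1) (Real.exp u) u := fun u =>
    (Real.hasDerivAt_exp u).sub_const 1
  have hF : ∀ u : ℝ, HasDerivAt (fun u => expGen a (Real.exp u - 1))
      (expGen (fun k => a (k + 1)) (Real.exp u - 1) * Real.exp u) u := fun u =>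
    (h.hasDerivAt _).comp u (hE u)
  have hG : ∀ u : ℝ, HasDerivAt (fun u => expGen (fun k => a (k + 1)) (Real.exp u - 1))
      (expGen (fun k => a (k + 2)) (Real.exp u - 1) * Real.exp u) u := fun u =>
    (h.hasDerivAt_shift _).comp u (hE u)
  have hd1 : ∀ {u : ℝ}, 0 ≤ u →
      HasDerivAt (fun u => Real.log (expGen a (Real.exp u - 1))) _ u :=
    fun {u} hu => (hF u).log (hpos hu).ne'
  have hd2 := fun {u : ℝ} (hu : 0 ≤ u) =>
    (((hG u).mul (Real.hasDerivAt_exp u)).div (hF u) (hpos hu).ne')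
  refine convexOn_of_hasDerivWithinAt2_nonneg (convex_Ici 0)
    (fun u hu => (hd1 hu).continuousAt.continuousWithinAt)
    (fun u hu => (hd1 (interior_subset hu)).hasDerivWithinAt)
    (fun u hu => (hd2 (interior_subset hu)).hasDerivWithinAt) ?_
  intro u hu
  have hu0 : 0 ≤ u := interior_subset hu
  have key := h.expGen_mul_add_nonneg (hx hu0)
  rw [add_sub_cancel] at key
  refine div_nonneg ?_ (sq_nonneg _)
  refine (mul_nonneg (Real.exp_pos u).le key).trans_eq ?_
  simp only [Pi.mul_apply]
  ring

theorem mul_le_log_expGen (h : SlowRatio a V) {u : ℝ} (hu : 0 ≤ u) :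
    V * u ≤ Real.log (expGen a (Real.exp u - 1)) := by
  rcases hu.eq_or_lt with rfl | hu
  · simp [h.expGen_zero]
  have hd : HasDerivAt (fun u => Real.log (expGen a (Real.exp u - 1))) V 0 := by
    have h0 : expGen (fun k => a (k + 1)) 0 = V := by
      rw [expGen, tsum_eq_single 0]
      · simp [h.one]
      · intro k hk
        simp [hk]
    have hE : HasDerivAt (fun u => Real.exp u - 1) (Real.exp 0) 0 :=
      (Real.hasDerivAt_exp 0).sub_const 1
    have hF : HasDerivAt (fun u => expGen a (Real.exp u - 1)) _ 0 := (h.hasDerivAt _).comp 0 hE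
    have := hF.log (by simp [h.expGen_zero])
    simpa [h0, h.expGen_zero] using this
  have := h.convexOn_log_expGen.le_slope_of_hasDerivAt Set.self_mem_Ici hu.le hu hd
  rw [slope_def_field, le_div_iff₀ (by linarith)] at this
  simpa [h.expGen_zero] using this

end SlowRatio

/-- The indicator that `y` is at distance at least `r` from every point of `x`. -/
def freeWeight (d : ℕ) (r : ℝ) (k : ℕ) (y : Euc d) (x : Fin k → Euc d) : ℝ :=
  ∏ i, if r ≤ dist y (x i) then (1 : ℝ) else 0

section Weights

variable {d : ℕ} {r : ℝ} {k : ℕ}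

theorem freeWeight_nonneg (y : Euc d) (x : Fin k → Euc d) : 0 ≤ freeWeight d r k y x :=
  Finset.prod_nonneg fun i _ => by split_ifs <;> norm_num

theorem freeWeight_le_one (y : Euc d) (x : Fin k → Euc d) : freeWeight d r k y x ≤ 1 :=
  Finset.prod_le_one (fun i _ => by split_ifs <;> norm_num) fun i _ => by split_ifs <;> norm_num

theorem hsWeight_nonneg (x : Fin k → Euc d) : 0 ≤ hsWeight d r k x :=
  Finset.prod_nonneg fun i _ => by split_ifs <;> norm_num

theorem hsWeight_le_one (x : Fin k → Euc d) : hsWeight d r k x ≤ 1 :=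
  Finset.prod_le_one (fun i _ => by split_ifs <;> norm_num) fun i _ => by split_ifs <;> norm_num

theorem freeWeight_cons (z y : Euc d) (x : Fin k → Euc d) :
    freeWeight d r (k + 1) z (Fin.cons y x)
      = (if r ≤ dist z y then (1 : ℝ) else 0) * freeWeight d r k z x := by
  simp [freeWeight, Fin.prod_univ_succ]

theorem hsWeight_eq_prod (x : Fin k → Euc d) :
    hsWeight d r k x
      = ∏ i, ∏ j, if i < j then (if r ≤ dist (x i) (x j) then (1 : ℝ) else 0) else 1 := by
  rw [hsWeight, Finset.prod_filter, ← Finset.univ_product_univ, Finset.prod_product]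

theorem hsWeight_cons (y : Euc d) (x : Fin k → Euc d) :
    hsWeight d r (k + 1) (Fin.cons y x) = freeWeight d r k y x * hsWeight d r k x := by
  simp [hsWeight_eq_prod, freeWeight, Fin.prod_univ_succ]

theorem Measurable.freeWeight {α : Type*} [MeasurableSpace α] {y : α → Euc d}
    {x : α → Fin k → Euc d} (hy : Measurable y) (hx : Measurable x) :
    Measurable fun q => freeWeight d r k (y q) (x q) := by
  unfold _root_.freeWeight
  refine Finset.measurable_prod _ fun i _ => Measurable.ite ?_ measurable_const measurable_const
  exact measurableSet_le measurable_const
    (hy.dist ((measurable_pi_apply i).comp hx))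

theorem measurable_hsWeight : Measurable (hsWeight d r k) := by
  unfold hsWeight
  refine Finset.measurable_prod _ fun q _ => Measurable.ite ?_ measurable_const measurable_const
  exact measurableSet_le measurable_const
    ((measurable_pi_apply q.1).dist (measurable_pi_apply q.2))

theorem measurable_finCons {α β : Type*} [MeasurableSpace α] [MeasurableSpace β] {y : α → β}
    {x : α → Fin k → β} (hy : Measurable y) (hx : Measurable x) :
    Measurable fun q => (Fin.cons (y q) (x q) : Fin (k + 1) → β) := by
  refine measurable_pi_iff.2 fun i => ?_
  refine Fin.cases ?_ (fun j => ?_) i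
  · simpa using hy
  · simpa [Function.comp_def] using (measurable_pi_apply j).comp hx

theorem integrable_of_measurable_of_bounds {α : Type*} [MeasurableSpace α] {ν : Measure α}
    [IsFiniteMeasure ν] {f : α → ℝ} (hf : Measurable f) (h0 : ∀ x, 0 ≤ f x) (C : ℝ)
    (h1 : ∀ x, f x ≤ C) : Integrable f ν :=
  Integrable.of_bound hf.aestronglyMeasurable C
    (Eventually.of_forall fun x => by rw [Real.norm_of_nonneg (h0 x)]; exact h1 x)

theorem integral_pi_cons {μ : Measure (Euc d)} [IsFiniteMeasure μ]
    {f : (Fin (k + 1) → Euc d) → ℝ} (hf : Integrable f (Measure.pi fun _ => μ)) :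
    ∫ x, f x ∂(Measure.pi fun _ : Fin (k + 1) => μ)
      = ∫ x, ∫ y, f (Fin.cons y x) ∂μ ∂(Measure.pi fun _ : Fin k => μ) := by
  have hmp := (measurePreserving_piFinSuccAbove (fun _ : Fin (k + 1) => μ) 0).symm
  rw [← hmp.integral_comp']
  rw [integral_prod_symm]
  · exact integral_congr_ae <| ae_of_all _ fun x => integral_congr_ae <| ae_of_all _ fun y =>
      congrArg f (Fin.insertNth_zero' y x)
  · exact (hmp.integrable_comp_emb (MeasurableEquiv.measurableEmbedding _)).2 hf

variable (μ : Measure (Euc d))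

/-- The free volume left by the configuration `x`. -/
def freeVolume (r : ℝ) (x : Fin k → Euc d) : ℝ := ∫ y, freeWeight d r k y x ∂μ

theorem freeVolume_nonneg (x : Fin k → Euc d) : 0 ≤ freeVolume μ r x :=
  integral_nonneg fun y => freeWeight_nonneg y x

variable [IsFiniteMeasure μ]

theorem measurable_freeVolume : Measurable (freeVolume (k := k) μ r) :=
  ((measurable_fst.freeWeight measurable_snd).stronglyMeasurable.integral_prod_left'
    (μ := μ)).measurable

theorem integrable_freeWeight (x : Fin k → Euc d) :
    Integrable (fun y => freeWeight d r k y x) μ := 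
  integrable_of_measurable_of_bounds (measurable_id.freeWeight measurable_const)
    (fun y => freeWeight_nonneg y x) 1 fun y => freeWeight_le_one y x

theorem freeVolume_le (x : Fin k → Euc d) : freeVolume μ r x ≤ μ.real Set.univ := by
  have := integral_mono (integrable_freeWeight (r := r) μ x) (integrable_const (1 : ℝ))
    fun y => freeWeight_le_one y x
  simpa [freeVolume] using this

theorem freeVolume_sub_one_le (hμ : ∀ y, μ.real (Metric.ball y r) ≤ 1) (y : Euc d)
    (x : Fin k → Euc d) :
    freeVolume μ r x - 1 ≤ freeVolume μ r (Fin.cons y x : Fin (k + 1) → Euc d) := by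
  have h1 : freeVolume μ r x - freeVolume μ r (Fin.cons y x : Fin (k + 1) → Euc d)
      ≤ ∫ z, (Metric.ball y r).indicator 1 z ∂μ := by
    rw [freeVolume, freeVolume, ← integral_sub (integrable_freeWeight μ x)
      (integrable_freeWeight μ _)]
    refine integral_mono ((integrable_freeWeight μ x).sub (integrable_freeWeight μ _))
      ((integrable_const (1 : ℝ)).indicator measurableSet_ball) fun z => ?_
    simp only [freeWeight_cons]
    have h2 := freeWeight_nonneg (r := r) z x
    have h3 := freeWeight_le_one (r := r) z x
    rcases lt_or_ge (dist z y) r with h | h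
    · rw [if_neg h.not_ge, Set.indicator_of_mem (Metric.mem_ball.2 h), Pi.one_apply]
      linarith
    · rw [if_pos h, Set.indicator_of_notMem fun h' => h.not_gt (Metric.mem_ball.1 h')]
      linarith
  rw [integral_indicator_one measurableSet_ball] at h1
  linarith [hμ y]

/-- The unnormalised weight of the `k`-point configurations. -/
def hsIntegral (r : ℝ) (k : ℕ) : ℝ := ∫ x, hsWeight d r k x ∂(Measure.pi fun _ : Fin k => μ)

theorem integrable_hsWeight :
    Integrable (hsWeight d r k) (Measure.pi fun _ : Fin k => μ) :=
  integrable_of_measurable_of_bounds measurable_hsWeight hsWeight_nonneg 1 hsWeight_le_one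

theorem integrable_freeVolume_pow_mul (n : ℕ) :
    Integrable (fun x => freeVolume μ r x ^ n * hsWeight d r k x)
      (Measure.pi fun _ : Fin k => μ) := by
  refine integrable_of_measurable_of_bounds
    (((measurable_freeVolume μ).pow_const n).mul measurable_hsWeight)
    (fun x => mul_nonneg (pow_nonneg (freeVolume_nonneg μ x) n) (hsWeight_nonneg x))
    (μ.real Set.univ ^ n * 1) fun x => ?_
  exact mul_le_mul (pow_le_pow_left₀ (freeVolume_nonneg μ x) (freeVolume_le μ x) n)
    (hsWeight_le_one x) (hsWeight_nonneg x) (by positivity)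

theorem hsIntegral_succ (k : ℕ) :
    hsIntegral μ r (k + 1)
      = ∫ x, freeVolume μ r x * hsWeight d r k x ∂(Measure.pi fun _ : Fin k => μ) := by
  rw [hsIntegral, integral_pi_cons (integrable_hsWeight μ)]
  simp only [hsWeight_cons, integral_mul_const, freeVolume]

theorem hsIntegral_succ_le (k : ℕ) :
    hsIntegral μ r (k + 1) ≤ μ.real Set.univ * hsIntegral μ r k := by
  rw [hsIntegral_succ, hsIntegral, ← integral_const_mul]
  refine integral_mono (by simpa using integrable_freeVolume_pow_mul (r := r) (k := k) μ 1)
    ((integrable_hsWeight μ).const_mul _) fun x => ?_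
  exact mul_le_mul_of_nonneg_right (freeVolume_le μ x) (hsWeight_nonneg x)

theorem integral_freeVolume_sq_le (hμ : ∀ y, μ.real (Metric.ball y r) ≤ 1) (k : ℕ) :
    ∫ x, freeVolume μ r x ^ 2 * hsWeight d r k x ∂(Measure.pi fun _ : Fin k => μ)
      ≤ hsIntegral μ r (k + 2) + hsIntegral μ r (k + 1) := by
  have hI1 : Integrable (fun x => freeVolume μ r x * hsWeight d r k x)
      (Measure.pi fun _ : Fin k => μ) := by
    simpa using integrable_freeVolume_pow_mul (r := r) (k := k) μ 1
  have hI2 : Integrable (fun x => freeVolume μ r x * hsWeight d r (k + 1) x)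
      (Measure.pi fun _ : Fin (k + 1) => μ) := by
    simpa using integrable_freeVolume_pow_mul (r := r) (k := k + 1) μ 1
  rw [← sub_le_iff_le_add, hsIntegral_succ μ (k + 1), integral_pi_cons hI2, hsIntegral_succ μ k,
    ← integral_sub (integrable_freeVolume_pow_mul μ 2) hI1]
  have hmeas : Measurable fun x : Fin (k + 1) → Euc d =>
      freeVolume μ r x * hsWeight d r (k + 1) x :=
    (measurable_freeVolume μ).mul measurable_hsWeight
  have hnn : ∀ x : Fin (k + 1) → Euc d, 0 ≤ freeVolume μ r x * hsWeight d r (k + 1) x :=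
    fun x => mul_nonneg (freeVolume_nonneg μ x) (hsWeight_nonneg x)
  have hle : ∀ x : Fin (k + 1) → Euc d,
      freeVolume μ r x * hsWeight d r (k + 1) x ≤ μ.real Set.univ * 1 := fun x =>
    mul_le_mul (freeVolume_le μ x) (hsWeight_le_one x) (hsWeight_nonneg x) (by positivity)
  have hint : Integrable (fun q : (Fin k → Euc d) × Euc d =>
      freeVolume μ r (Fin.cons q.2 q.1 : Fin (k + 1) → Euc d)
        * hsWeight d r (k + 1) (Fin.cons q.2 q.1)) ((Measure.pi fun _ : Fin k => μ).prod μ) :=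
    integrable_of_measurable_of_bounds
      (hmeas.comp (measurable_finCons measurable_snd measurable_fst)) (fun q => hnn _) _
      fun q => hle _
  refine integral_mono ((integrable_freeVolume_pow_mul μ 2).sub hI1) hint.integral_prod_left
    fun x => ?_
  have hx : Integrable (fun y => freeVolume μ r (Fin.cons y x : Fin (k + 1) → Euc d)
        * hsWeight d r (k + 1) (Fin.cons y x)) μ :=
    integrable_of_measurable_of_bounds
      (hmeas.comp (measurable_finCons measurable_id measurable_const))
      (fun y => hnn _) _ fun y => hle _
  calc freeVolume μ r x ^ 2 * hsWeight d r k x - freeVolume μ r x * hsWeight d r k x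
      = ∫ y, (freeVolume μ r x - 1) * (freeWeight d r k y x * hsWeight d r k x) ∂μ := by
        rw [integral_const_mul, integral_mul_const, ← freeVolume]
        ring
    _ ≤ _ := by
        refine integral_mono (((integrable_freeWeight μ x).mul_const _).const_mul _) hx fun y => ?_
        simp only [hsWeight_cons]
        exact mul_le_mul_of_nonneg_right (freeVolume_sub_one_le μ hμ y x)
          (mul_nonneg (freeWeight_nonneg y x) (hsWeight_nonneg x))

theorem hsIntegral_succ_sq_le (k : ℕ) :
    hsIntegral μ r (k + 1) ^ 2 ≤ hsIntegral μ r k *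
      ∫ x, freeVolume μ r x ^ 2 * hsWeight d r k x ∂(Measure.pi fun _ : Fin k => μ) := by
  have hI1 : Integrable (fun x => freeVolume μ r x * hsWeight d r k x)
      (Measure.pi fun _ : Fin k => μ) := by
    simpa using integrable_freeVolume_pow_mul (r := r) (k := k) μ 1
  have hI0 := integrable_hsWeight (r := r) (k := k) μ
  have hI2 := integrable_freeVolume_pow_mul (r := r) (k := k) μ 2
  have hq : ∀ c : ℝ, 0 ≤ hsIntegral μ r k * (c * c) + (-2 * hsIntegral μ r (k + 1)) * c +
      ∫ x, freeVolume μ r x ^ 2 * hsWeight d r k x ∂(Measure.pi fun _ : Fin k => μ) := by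
    intro c
    have h0 : 0 ≤ ∫ x, (c * c * hsWeight d r k x + -2 * c * (freeVolume μ r x * hsWeight d r k x)
        + freeVolume μ r x ^ 2 * hsWeight d r k x) ∂(Measure.pi fun _ : Fin k => μ) := by
      refine integral_nonneg fun x => ?_
      refine (mul_nonneg (sq_nonneg (freeVolume μ r x - c))
        (hsWeight_nonneg (r := r) x)).trans_eq ?_
      ring
    have hI01 : Integrable (fun x => c * c * hsWeight d r k x
        + -2 * c * (freeVolume μ r x * hsWeight d r k x)) (Measure.pi fun _ : Fin k => μ) :=
      (hI0.const_mul _).add (hI1.const_mul _)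
    rw [integral_add hI01 hI2,
      integral_add (hI0.const_mul _) (hI1.const_mul _), integral_const_mul, integral_const_mul,
      ← hsIntegral_succ, ← hsIntegral] at h0
    linarith
  have := discrim_le_zero hq
  rw [discrim] at this
  linarith

theorem slowRatio_hsIntegral (hμ : ∀ y, μ.real (Metric.ball y r) ≤ 1) :
    SlowRatio (hsIntegral μ r) (μ.real Set.univ) where
  zero := by simp [hsIntegral, hsWeight, Measure.real]
  one := by
    rw [hsIntegral_succ]
    simp [hsWeight, freeVolume, freeWeight, Measure.real]
  nonneg k := integral_nonneg fun x => hsWeight_nonneg x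
  le_pow k := by
    induction k with
    | zero => simp [hsIntegral, hsWeight, Measure.real]
    | succ k ih =>
      refine (hsIntegral_succ_le μ k).trans ?_
      rw [pow_succ']
      exact mul_le_mul_of_nonneg_left ih measureReal_nonneg
  sq_le k := (hsIntegral_succ_sq_le μ k).trans <|
    mul_le_mul_of_nonneg_left (integral_freeVolume_sq_le μ hμ k)
      (integral_nonneg fun x => hsWeight_nonneg x)

end Weights

theorem volume_cube {d : ℕ} (hd : 1 ≤ d) {V : ℝ} (hV : 0 ≤ V) :
    volume (cube d V) = ENNReal.ofReal V := by
  have h1 : cube d V = (WithLp.ofLp : Euc d → Fin d → ℝ) ⁻¹'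
      (Set.univ.pi fun _ => Set.Icc (-(V ^ (1 / (d : ℝ)) / 2)) (V ^ (1 / (d : ℝ)) / 2)) := by
    ext x
    simp [cube, abs_le, -Set.pi_univ_Icc]
  have hd0 : (d : ℝ) ≠ 0 := by positivity
  rw [h1, (PiLp.volume_preserving_ofLp (Fin d)).measure_preimage
    (MeasurableSet.univ_pi fun _ => measurableSet_Icc).nullMeasurableSet, volume_pi_pi]
  simp only [Real.volume_Icc, sub_neg_eq_add, add_halves, Finset.prod_const, Finset.card_univ,
    Fintype.card_fin]
  rw [← ENNReal.ofReal_pow (by positivity), ← Real.rpow_natCast, ← Real.rpow_mul hV,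
    one_div_mul_cancel hd0, Real.rpow_one]

/-- The partition function on a cube is the generating function of a `SlowRatio` sequence. -/
theorem exists_slowRatio_Zhs {d : ℕ} (hd : 1 ≤ d) {r : ℝ}
    (hvol : volume (Metric.ball (0 : Euc d) r) = 1) {V : ℝ} (hV : 0 ≤ V) :
    ∃ a : ℕ → ℝ, SlowRatio a V ∧ Zhs d r (cube d V) = expGen a := by
  set μ : Measure (Euc d) := volume.restrict (cube d V) with hμdef
  have hμuniv : μ Set.univ = ENNReal.ofReal V := by
    rw [hμdef, Measure.restrict_apply_univ, volume_cube hd hV]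
  have : IsFiniteMeasure μ := ⟨by rw [hμuniv]; exact ENNReal.ofReal_lt_top⟩
  have hμ : ∀ y, μ.real (Metric.ball y r) ≤ 1 := by
    intro y
    have h1 : μ (Metric.ball y r) ≤ 1 := by
      refine (Measure.restrict_apply_le _ _).trans_eq ?_
      rw [Measure.addHaar_ball_center, hvol]
    simpa [Measure.real] using ENNReal.toReal_mono ENNReal.one_ne_top h1
  refine ⟨hsIntegral μ r, ?_, ?_⟩
  · have := slowRatio_hsIntegral μ hμ
    rwa [Measure.real, hμuniv, ENNReal.toReal_ofReal hV] at this
  · ext x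
    simp only [Zhs, expGen, hsIntegral]
    simp only [volume_pi, Measure.restrict_pi_pi, hμdef]

/-- A holomorphic function that expands distances along a set, up to a constant factor, is
injective near that set. -/
theorem exists_isOpen_injOn_of_expanding {g : ℂ → ℂ} {S : Set ℂ} {c : ℝ} (hc : 0 < c)
    (hg : ∀ x ∈ S, AnalyticAt ℂ g x) (hd : ∀ x ∈ S, deriv g x ≠ 0)
    (hS : ∀ x ∈ S, ∀ y ∈ S, c * dist x y ≤ dist (g x) (g y)) :
    ∃ U, IsOpen U ∧ S ⊆ U ∧ Set.InjOn g U ∧ ∀ z ∈ U, AnalyticAt ℂ g z ∧ deriv g z ≠ 0 := by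
  have hloc : ∀ x : S, ∃ η > 0, ∃ ε > 0, ε ≤ η ∧
      (∀ z ∈ Metric.ball (x : ℂ) ε, dist (g z) (g x) < η) ∧
      Set.InjOn g (Metric.ball (x : ℂ) (2 * η / c + η)) ∧
      ∀ z ∈ Metric.ball (x : ℂ) ε, AnalyticAt ℂ g z ∧ deriv g z ≠ 0 := by
    rintro ⟨x, hx⟩
    have hst : HasStrictDerivAt g (deriv g x) x := (hg x hx).hasStrictDerivAt
    have h1 := hst.eventually_left_inverse (hd x hx)
    obtain ⟨δ, hδ, hδs⟩ := Metric.eventually_nhds_iff_ball.1 h1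
    have h2 : ∀ᶠ z in nhds x, AnalyticAt ℂ g z ∧ deriv g z ≠ 0 :=
      (hg x hx).eventually_analyticAt.and
        ((hg x hx).deriv.continuousAt.eventually_ne (hd x hx))
    set η := δ / (2 / c + 1) with hη
    have hη0 : 0 < η := by positivity
    have hηδ : 2 * η / c + η = δ := by rw [hη]; field_simp
    have h3 : ∀ᶠ z in nhds x, dist (g z) (g x) < η :=
      (hg x hx).continuousAt.eventually (Metric.ball_mem_nhds _ hη0)
    obtain ⟨ε, hε, hεs⟩ := Metric.eventually_nhds_iff_ball.1 (h2.and h3)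
    refine ⟨η, hη0, min ε η, lt_min hε hη0, min_le_right _ _, ?_, ?_, ?_⟩
    · exact fun z hz => (hεs z (Metric.ball_subset_ball (min_le_left _ _) hz)).2
    · rw [hηδ]
      intro z hz w hw hzw
      rw [← hδs z hz, ← hδs w hw, hzw]
    · exact fun z hz => (hεs z (Metric.ball_subset_ball (min_le_left _ _) hz)).1
  choose η hη ε hε hεη hclose hinj hgood using hloc
  refine ⟨⋃ x : S, Metric.ball (x : ℂ) (ε x), isOpen_iUnion fun x => Metric.isOpen_ball,
    fun x hx => Set.mem_iUnion.2 ⟨⟨x, hx⟩, Metric.mem_ball_self (hε _)⟩, ?_, ?_⟩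
  · have main : ∀ x y : S, η y ≤ η x → ∀ z ∈ Metric.ball (x : ℂ) (ε x),
        ∀ w ∈ Metric.ball (y : ℂ) (ε y), g z = g w → z = w := by
      intro x y hxy z hz w hw hzw
      have h1 := hclose x z hz
      have h2 := hclose y w hw
      rw [← hzw] at h2
      have h3 : dist (g x) (g y) < 2 * η x := by
        have := dist_triangle_left (g x) (g y) (g z)
        linarith
      have h4 : dist (x : ℂ) y < 2 * η x / c := by
        rw [lt_div_iff₀ hc, mul_comm]
        exact (hS x x.2 y y.2).trans_lt h3
      have h5 : 0 ≤ 2 * η x / c := by have := hη x; positivity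
      refine hinj x ?_ ?_ hzw
      · have := Metric.mem_ball.1 hz
        exact Metric.mem_ball.2 (by linarith [hεη x])
      · have h6 := Metric.mem_ball.1 hw
        have h7 := dist_triangle w (y : ℂ) x
        rw [dist_comm (y : ℂ) x] at h7
        exact Metric.mem_ball.2 (by linarith [hεη y])
    intro z hz w hw hzw
    obtain ⟨x, hx⟩ := Set.mem_iUnion.1 hz
    obtain ⟨y, hy⟩ := Set.mem_iUnion.1 hw
    rcases le_total (η y) (η x) with h | h
    · exact main x y h z hx w hy hzw
    · exact (main y x h w hy z hx hzw.symm).symm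
  · intro z hz
    obtain ⟨x, hx⟩ := Set.mem_iUnion.1 hz
    exact hgood x z hx

/-- An analytic function is an analytic function of any injective holomorphic coordinate. -/
theorem exists_analyticOnNhd_comp_eq {g p : ℂ → ℂ} {U : Set ℂ} (hU : IsOpen U)
    (hinj : Set.InjOn g U) (hg : ∀ z ∈ U, AnalyticAt ℂ g z ∧ deriv g z ≠ 0)
    (hp : AnalyticOnNhd ℂ p U) :
    IsOpen (g '' U) ∧ ∃ f : ℂ → ℂ, AnalyticOnNhd ℂ f (g '' U) ∧ ∀ z ∈ U, f (g z) = p z := by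
  have hopen : IsOpen (g '' U) := by
    rw [isOpen_iff_mem_nhds]
    rintro _ ⟨z, hz, rfl⟩
    rw [← (hg z hz).1.hasStrictDerivAt.map_nhds_eq (hg z hz).2]
    exact image_mem_map (hU.mem_nhds hz)
  have hleft : ∀ z ∈ U, Function.invFunOn g U (g z) = z := fun z hz =>
    hinj.leftInvOn_invFunOn hz
  refine ⟨hopen, p ∘ Function.invFunOn g U, ?_, fun z hz => by simp [hleft z hz]⟩
  rw [Complex.analyticOnNhd_iff_differentiableOn hopen]
  rintro _ ⟨z, hz, rfl⟩
  have hinv := (hg z hz).1.hasStrictDerivAt.to_local_left_inverse (hg z hz).2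
    (g := Function.invFunOn g U) (by filter_upwards [hU.mem_nhds hz] with w hw using hleft w hw)
  refine (DifferentiableAt.comp _ ?_ hinv.hasDerivAt.differentiableAt).differentiableWithinAt
  rw [hleft z hz]
  exact (hp z hz).differentiableAt

/-- The derivative of a function that is convex in the variable `log (1 + x)`. -/
theorem one_add_mul_deriv_monotone {P q : ℝ → ℝ} {b : ℝ} (hb : 0 < b)
    (hd : ∀ x ∈ Set.Ico 0 b, HasDerivAt P (q x) x) (h0 : P 0 = 0)
    (hconv : ConvexOn ℝ (Set.Ico 0 (Real.log (1 + b))) fun u => P (Real.exp u - 1))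
    (hlow : ∀ u ∈ Set.Ico 0 (Real.log (1 + b)), u ≤ P (Real.exp u - 1)) :
    MonotoneOn (fun x => (1 + x) * q x) (Set.Ico 0 b) ∧ ∀ x ∈ Set.Ico 0 b, 1 ≤ (1 + x) * q x := by
  have hlog : ∀ x ∈ Set.Ico 0 b, Real.log (1 + x) ∈ Set.Ico 0 (Real.log (1 + b)) := fun x hx =>
    ⟨Real.log_nonneg (by linarith [hx.1]),
      Real.log_lt_log (by linarith [hx.1]) (by linarith [hx.2])⟩
  have hder : ∀ x ∈ Set.Ico 0 b,
      HasDerivAt (fun u => P (Real.exp u - 1)) ((1 + x) * q x) (Real.log (1 + x)) := by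
    intro x hx
    have hx1 : Real.exp (Real.log (1 + x)) = 1 + x := Real.exp_log (by linarith [hx.1])
    have h1 : HasDerivAt (fun u => Real.exp u - 1) (1 + x) (Real.log (1 + x)) := by
      simpa only [hx1] using (Real.hasDerivAt_exp (Real.log (1 + x))).sub_const 1
    have h2 : HasDerivAt P (q x) ((fun u => Real.exp u - 1) (Real.log (1 + x))) := by
      beta_reduce
      rw [hx1, add_sub_cancel_left]
      exact hd x hx
    rw [mul_comm]
    exact h2.comp (Real.log (1 + x)) h1
  have hmono : MonotoneOn (fun x => (1 + x) * q x) (Set.Ico 0 b) := by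
    intro x hx y hy hxy
    rcases hxy.eq_or_lt with rfl | hlt
    · exact le_rfl
    have hlt' : Real.log (1 + x) < Real.log (1 + y) :=
      Real.log_lt_log (by linarith [hx.1]) (by linarith)
    exact (hconv.le_slope_of_hasDerivAt (hlog x hx) (hlog y hy) hlt' (hder x hx)).trans
      (hconv.slope_le_of_hasDerivAt (hlog x hx) (hlog y hy) hlt' (hder y hy))
  have hmem0 : (0 : ℝ) ∈ Set.Ico 0 b := ⟨le_rfl, hb⟩
  refine ⟨hmono, fun x hx => le_trans ?_ (hmono hmem0 hx hx.1)⟩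
  have hL : 0 < Real.log (1 + b) := Real.log_pos (by linarith)
  have ht := (hasDerivWithinAt_iff_tendsto_slope' Set.self_notMem_Ioi).1
    ((hder 0 hmem0).hasDerivWithinAt (s := Set.Ioi (Real.log (1 + 0))))
  refine ge_of_tendsto ht ?_
  simp only [add_zero, Real.log_one]
  filter_upwards [Ioo_mem_nhdsGT hL] with u hu
  rw [slope_def_field, le_div_iff₀ (by linarith [hu.1])]
  simpa [h0] using hlow u ⟨hu.1.le, hu.2⟩

/-- Growth of the density once `(1 + x) q x` is nondecreasing and at least one. -/
theorem div_le_mul_sub_mul {q : ℝ → ℝ} {b : ℝ}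
    (hmono : MonotoneOn (fun x => (1 + x) * q x) (Set.Ico 0 b))
    (hone : ∀ x ∈ Set.Ico 0 b, 1 ≤ (1 + x) * q x) {x y : ℝ} (hx : x ∈ Set.Ico 0 b)
    (hy : y ∈ Set.Ico 0 b) (hxy : x ≤ y) :
    (y - x) / ((1 + x) * (1 + y)) ≤ y * q y - x * q x := by
  have hx0 : 0 < 1 + x := by linarith [hx.1]
  have hy0 : 0 < 1 + y := by linarith [hy.1]
  have h1 := hone y hy
  have h2 : (1 + x) * q x ≤ (1 + y) * q y := hmono hx hy hxy
  rw [div_le_iff₀ (by positivity)]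
  have h3 : x * (1 + y) * ((1 + x) * q x) ≤ x * (1 + y) * ((1 + y) * q y) :=
    mul_le_mul_of_nonneg_left h2 (mul_nonneg hx.1 hy0.le)
  have h4 : (y - x) * 1 ≤ (y - x) * ((1 + y) * q y) :=
    mul_le_mul_of_nonneg_left h1 (by linarith)
  nlinarith

/-- The derivative of a holomorphic function with real values on an interval is real there. -/
theorem deriv_im_eq_zero_of_im_eq_zero {p : ℂ → ℂ} {b : ℝ}
    (hp : ∀ x ∈ Set.Ico 0 b, DifferentiableAt ℂ p ((x : ℝ) : ℂ))
    (him : ∀ x ∈ Set.Ico 0 b, (p ((x : ℝ) : ℂ)).im = 0) {x : ℝ} (hx : x ∈ Set.Ico 0 b) :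
    (deriv p (x : ℂ)).im = 0 := by
  have h1 : HasDerivAt (fun t : ℝ => (p (t : ℂ)).im) (deriv p (x : ℂ)).im x :=
    Complex.imCLM.hasFDerivAt.comp_hasDerivAt x (hp x hx).hasDerivAt.comp_ofReal
  have h2 : HasDerivWithinAt (fun t : ℝ => (p (t : ℂ)).im) 0 (Set.Ico 0 b) x :=
    (hasDerivWithinAt_const x _ (0 : ℝ)).congr him (him x hx)
  exact (uniqueDiffOn_Ico 0 b x hx).eq_deriv _ h1.hasDerivWithinAt h2

/-- A holomorphic function that is expanding along a real interval has nonzero derivative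
there. -/
theorem deriv_ne_zero_of_expanding {g : ℂ → ℂ} {b c x : ℝ} (hc : 0 < c)
    (hS : ∀ y ∈ Set.Ioo x b, c * dist x y ≤ dist (g x) (g y)) (hx : x < b)
    (hg : DifferentiableAt ℂ g x) : deriv g x ≠ 0 := by
  intro h0
  have h1 : HasDerivAt (fun t : ℝ => g t) (deriv g x) x := hg.hasDerivAt.comp_ofReal
  have ht := (hasDerivWithinAt_iff_tendsto_slope' Set.self_notMem_Ioi).1
    (h1.hasDerivWithinAt (s := Set.Ioi x))
  have hle : c ≤ ‖deriv g x‖ := by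
    refine ge_of_tendsto ht.norm ?_
    filter_upwards [Ioo_mem_nhdsGT hx] with y hy
    have hxy : 0 < y - x := sub_pos.2 hy.1
    have := hS y hy
    rw [dist_comm x, dist_comm (g x), Real.dist_eq, abs_of_pos hxy, dist_eq_norm] at this
    rw [slope_def_module, norm_smul, norm_inv, Real.norm_of_nonneg hxy.le,
      le_inv_mul_iff₀ hxy, mul_comm]
    exact this
  rw [h0, norm_zero] at hle
  linarith

/-- Convexity of the pressure in the variable `log (1 + λ)`, with its consequences at the
origin. -/
theorem pressure_convex {d : ℕ} (hd : 1 ≤ d) {r : ℝ}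
    (hvol : volume (Metric.ball (0 : Euc d) r) = 1) {P : ℝ → ℝ} {b : ℝ} (hb : 0 < b)
    (hconv : ∀ x ∈ Set.Ico 0 b,
      Tendsto (fun V : ℝ => V⁻¹ * Real.log (Zhs d r (cube d V) x)) atTop (nhds (P x))) :
    P 0 = 0 ∧ ConvexOn ℝ (Set.Ico 0 (Real.log (1 + b))) (fun u => P (Real.exp u - 1)) ∧
      ∀ u ∈ Set.Ico 0 (Real.log (1 + b)), u ≤ P (Real.exp u - 1) := by
  have hlim : ∀ u ∈ Set.Ico 0 (Real.log (1 + b)),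
      Tendsto (fun V : ℝ => V⁻¹ * Real.log (Zhs d r (cube d V) (Real.exp u - 1))) atTop
        (nhds (P (Real.exp u - 1))) := by
    intro u hu
    have h1 := Real.one_le_exp hu.1
    have h2 := (Real.lt_log_iff_exp_lt (by linarith : 0 < 1 + b)).1 hu.2
    exact hconv _ ⟨by linarith, by linarith⟩
  refine ⟨?_, ⟨convex_Ico _ _, ?_⟩, ?_⟩
  · refine tendsto_nhds_unique (hconv 0 ⟨le_rfl, hb⟩) (tendsto_const_nhds.congr' ?_)
    filter_upwards [eventually_ge_atTop 0] with V hV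
    obtain ⟨a, ha, hZ⟩ := exists_slowRatio_Zhs hd hvol hV
    rw [hZ, ha.expGen_zero, Real.log_one, mul_zero]
  · intro u hu v hv s t hs ht hst
    refine le_of_tendsto_of_tendsto (hlim _ (convex_Ico _ _ hu hv hs ht hst))
      (((hlim u hu).const_mul s).add ((hlim v hv).const_mul t)) ?_
    filter_upwards [eventually_ge_atTop 0] with V hV
    obtain ⟨a, ha, hZ⟩ := exists_slowRatio_Zhs hd hvol hV
    have := mul_le_mul_of_nonneg_left
      (ha.convexOn_log_expGen.2 (Set.mem_Ici.2 hu.1) (Set.mem_Ici.2 hv.1) hs ht hst)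
      (inv_nonneg.2 hV)
    simp only [smul_eq_mul] at this ⊢
    rw [hZ]
    linarith
  · intro u hu
    refine ge_of_tendsto (hlim u hu) ?_
    filter_upwards [eventually_gt_atTop 0] with V hV
    obtain ⟨a, ha, hZ⟩ := exists_slowRatio_Zhs hd hvol hV.le
    rw [hZ, le_inv_mul_iff₀ hV]
    exact ha.mul_le_log_expGen hu.1

/-- Corollary 1.4 (first statement): the hard sphere pressure is analytic as a
function of the density `ρ_φ(λ) = λ p'(λ)` for densities in `[0, e/(1+e))`,
i.e. packing densities up to `(e/(1+e))·2^{-d}`. -/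
theorem hard_sphere_pressure_analytic_in_density
    (d : ℕ) (hd : 1 ≤ d)
    (r : ℝ) (hr : 0 < r)
    (hvol : volume (Metric.ball (0 : Euc d) r) = 1)
    (Ω : Set ℂ) (hΩ : IsOpen Ω)
    (hΩmem : ∀ lam : ℝ, lam ∈ Set.Ico 0 (Real.exp 1) → (lam : ℂ) ∈ Ω)
    (p : ℂ → ℂ) (hp : AnalyticOnNhd ℂ p Ω)
    (hconv : ∀ lam : ℝ, lam ∈ Set.Ico 0 (Real.exp 1) →
      Tendsto (fun V : ℝ => ((V⁻¹ * Real.log (Zhs d r (cube d V) lam) : ℝ) : ℂ))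
        atTop (nhds (p lam))) :
    (∀ s : ℝ, s ∈ Set.Ico 0 (Real.exp 1 / (1 + Real.exp 1)) →
      ∃ lam : ℝ, lam ∈ Set.Ico 0 (Real.exp 1) ∧
        (lam : ℂ) * deriv p (lam : ℂ) = (s : ℂ)) ∧
    (∃ D : Set ℂ, IsOpen D ∧
      (∀ s : ℝ, s ∈ Set.Ico 0 (Real.exp 1 / (1 + Real.exp 1)) → (s : ℂ) ∈ D) ∧
      ∃ f : ℂ → ℂ, AnalyticOnNhd ℂ f D ∧
        ∀ lam : ℝ, lam ∈ Set.Ico 0 (Real.exp 1) →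
          (lam : ℂ) * deriv p (lam : ℂ) ∈ D →
          f ((lam : ℂ) * deriv p (lam : ℂ)) = p (lam : ℂ)) := by
  have he : (0 : ℝ) < Real.exp 1 := Real.exp_pos 1
  set b := Real.exp 1 with hbdef
  have hpd : ∀ x ∈ Set.Ico 0 b, DifferentiableAt ℂ p ((x : ℝ) : ℂ) := fun x hx =>
    (hp x (hΩmem x hx)).differentiableAt
  have him : ∀ x ∈ Set.Ico 0 b, (p ((x : ℝ) : ℂ)).im = 0 := by
    intro x hx
    have := (Complex.continuous_im.tendsto _).comp (hconv x hx)
    exact tendsto_nhds_unique this (by simp [Function.comp_def])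
  have hre : ∀ x ∈ Set.Ico 0 b, Tendsto (fun V : ℝ => V⁻¹ * Real.log (Zhs d r (cube d V) x))
      atTop (nhds (p ((x : ℝ) : ℂ)).re) := fun x hx =>
    (Complex.continuous_re.tendsto _).comp (hconv x hx)
  obtain ⟨h0, hcvx, hlow⟩ := pressure_convex hd hvol (P := fun x => (p (x : ℂ)).re) he hre
  set q : ℝ → ℝ := fun x => (deriv p (x : ℂ)).re with hq
  obtain ⟨hmono, hone⟩ := one_add_mul_deriv_monotone (q := q) he
    (fun x hx => (hpd x hx).hasDerivAt.real_of_complex) h0 hcvx hlow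
  have hρ : ∀ x ∈ Set.Ico 0 b, ((x : ℝ) : ℂ) * deriv p x = ((x * q x : ℝ) : ℂ) := by
    intro x hx
    rw [Complex.ofReal_mul, hq]
    congr 1
    exact Complex.ext rfl (deriv_im_eq_zero_of_im_eq_zero hpd him hx)
  have hi : ∀ s ∈ Set.Ico 0 (b / (1 + b)), ∃ x ∈ Set.Ico 0 b,
      ((x : ℝ) : ℂ) * deriv p x = ((s : ℝ) : ℂ) := by
    intro s hs
    have hs1 : s * (1 + b) < b := (lt_div_iff₀ (by linarith)).1 hs.2
    have hs2 : 0 < 1 - s := by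
      by_contra! h
      nlinarith
    have hy0 : 0 ≤ s / (1 - s) := div_nonneg hs.1 hs2.le
    have hyb : s / (1 - s) < b := by rw [div_lt_iff₀ hs2]; linarith
    have hcont : ContinuousOn (fun x : ℝ => x * q x) (Set.Icc 0 (s / (1 - s))) := by
      refine continuousOn_id.mul fun x hx => ?_
      have h1 : ContinuousAt (deriv p) (x : ℂ) :=
        (hp x (hΩmem x ⟨hx.1, hx.2.trans_lt hyb⟩)).deriv.continuousAt
      exact (Complex.continuous_re.continuousAt.comp
        (h1.comp Complex.continuous_ofReal.continuousAt)).continuousWithinAt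
    have hend := div_le_mul_sub_mul hmono hone ⟨le_rfl, he⟩ ⟨hy0, hyb⟩ hy0
    have hval : (s / (1 - s) - 0) / ((1 + 0) * (1 + s / (1 - s))) = s := by
      field_simp
      ring
    rw [hval, zero_mul, sub_zero] at hend
    obtain ⟨x, hx, hxs⟩ := intermediate_value_Icc hy0 hcont
      (show s ∈ Set.Icc _ _ from ⟨by simpa using hs.1, hend⟩)
    have hx' : x ∈ Set.Ico 0 b := ⟨hx.1, hx.2.trans_lt hyb⟩
    exact ⟨x, hx', by rw [hρ x hx', ← hxs]⟩
  refine ⟨hi, ?_⟩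
  set c : ℝ := 1 / (1 + b) ^ 2 with hcdef
  have hc : 0 < c := by positivity
  have hexp : ∀ x ∈ Set.Ico 0 b, ∀ y ∈ Set.Ico 0 b, x ≤ y → c * (y - x) ≤ y * q y - x * q x := by
    intro x hx y hy hxy
    refine le_trans ?_ (div_le_mul_sub_mul hmono hone hx hy hxy)
    rw [hcdef, one_div_mul_eq_div]
    have hx1 : 0 < 1 + x := by linarith [hx.1]
    have hy1 : 0 < 1 + y := by linarith [hy.1]
    refine div_le_div_of_nonneg_left (sub_nonneg.2 hxy) (by positivity) ?_
    rw [sq]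
    exact mul_le_mul (by linarith [hx.2]) (by linarith [hy.2]) hy1.le (by linarith)
  have hdist : ∀ x ∈ Set.Ico 0 b, ∀ y ∈ Set.Ico 0 b,
      c * dist x y ≤ dist (((x : ℝ) : ℂ) * deriv p x) (((y : ℝ) : ℂ) * deriv p y) := by
    intro x hx y hy
    rw [hρ x hx, hρ y hy, Complex.dist_of_im_eq (by simp), Complex.ofReal_re, Complex.ofReal_re,
      Real.dist_eq, Real.dist_eq]
    rcases le_total x y with h | h
    · rw [abs_sub_comm, abs_of_nonneg (sub_nonneg.2 h), abs_sub_comm]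
      exact (hexp x hx y hy h).trans (le_abs_self _)
    · rw [abs_of_nonneg (sub_nonneg.2 h)]
      exact (hexp y hy x hx h).trans (le_abs_self _)
  have hgan : ∀ z ∈ Ω, AnalyticAt ℂ (fun z => z * deriv p z) z := fun z hz =>
    analyticAt_id.mul (hp z hz).deriv
  obtain ⟨U, hUo, hSU, hUinj, hUg⟩ := exists_isOpen_injOn_of_expanding
    (g := fun z => z * deriv p z) (S := (fun x : ℝ => (x : ℂ)) '' Set.Ico 0 b) hc
    (by rintro _ ⟨x, hx, rfl⟩; exact hgan x (hΩmem x hx))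
    (by
      rintro _ ⟨x, hx, rfl⟩
      exact deriv_ne_zero_of_expanding (b := b) hc
        (fun y hy => hdist x hx y ⟨hx.1.trans hy.1.le, hy.2⟩) hx.2
        (hgan x (hΩmem x hx)).differentiableAt)
    (by
      rintro _ ⟨x, hx, rfl⟩ _ ⟨y, hy, rfl⟩
      simpa only [Complex.dist_of_im_eq (z := (x : ℂ)) (w := (y : ℂ)) (by simp),
        Complex.ofReal_re] using hdist x hx y hy)
  have hmem : ∀ x ∈ Set.Ico 0 b, ((x : ℝ) : ℂ) ∈ U ∩ Ω := fun x hx =>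
    ⟨hSU ⟨x, hx, rfl⟩, hΩmem x hx⟩
  obtain ⟨hDo, f, hf, hfp⟩ := exists_analyticOnNhd_comp_eq (p := p) (hUo.inter hΩ)
    (hUinj.mono Set.inter_subset_left) (fun z hz => hUg z hz.1) (hp.mono Set.inter_subset_right)
  refine ⟨_, hDo, fun s hs => ?_, f, hf, fun x hx _ => hfp x (hmem x hx)⟩
  obtain ⟨x, hx, hxs⟩ := hi s hs
  exact ⟨x, hmem x hx, hxs⟩

end
end
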